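/- arXiv:1607.01117 — 7 statements merged into one kernel-verified Lean document; each statement's English description precedes it below -/
import Mathlib

section
/- Anagram-free vertex colouring is not bounded by maximum degree 3: for every positive integer c there exists a (finite simple) graph G with maximum degree at most 3 such that G has no anagram-free vertex colouring using at most c colours. -/
/-- A word is an *anagram* if it has the form `w₁ ++ w₂` where `w₁` is non-empty
and `w₂` is a permutation of `w₁`. -/
def IsAnagram {α : Type*} (l : List α) : Prop :=
  ∃ w₁ w₂ : List α, w₁ ≠ [] ∧ List.Perm w₁ w₂ ∧ l = w₁ ++ w₂

/-- A word is a *`k`-anagram* if it is a concatenation of `k` permutations of a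
fixed non-empty word `W`. -/
def IsKAnagram {α : Type*} (k : ℕ) (l : List α) : Prop :=
  ∃ (W : List α) (ws : List (List α)), W ≠ [] ∧ ws.length = k ∧
    (∀ w ∈ ws, List.Perm w W) ∧ l = ws.flatten

/-- A vertex colouring `f` of a graph `G` is *anagram-free* if the colour
sequence on the vertices of every path of `G` is not an anagram. -/
def AnagramFreeVC {V C : Type*} (G : SimpleGraph V) (f : V → C) : Prop :=
  ∀ ⦃u v : V⦄ (p : G.Walk u v), p.IsPath → ¬ IsAnagram (p.support.map f)

/-- An edge colouring `f` of a graph `G` is *anagram-free* if the colour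
sequence on the edges of every path of `G` is not an anagram. -/
def AnagramFreeEC {V C : Type*} (G : SimpleGraph V) (f : Sym2 V → C) : Prop :=
  ∀ ⦃u v : V⦄ (p : G.Walk u v), p.IsPath → ¬ IsAnagram (p.edges.map f)

/-- A vertex colouring `f` of a graph `G` is *`k`-anagram-free* if the colour
sequence on the vertices of every path of `G` is not a `k`-anagram. -/
def KAnagramFreeVC {V C : Type*} (k : ℕ) (G : SimpleGraph V) (f : V → C) : Prop :=
  ∀ ⦃u v : V⦄ (p : G.Walk u v), p.IsPath → ¬ IsKAnagram k (p.support.map f)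

/-- An edge colouring `f` of a graph `G` is *`k`-anagram-free* if the colour
sequence on the edges of every path of `G` is not a `k`-anagram. -/
def KAnagramFreeEC {V C : Type*} (k : ℕ) (G : SimpleGraph V) (f : Sym2 V → C) : Prop :=
  ∀ ⦃u v : V⦄ (p : G.Walk u v), p.IsPath → ¬ IsKAnagram k (p.edges.map f)

/-- The vertex set of the complete `d`-ary tree of height `h`: sequences of
branching choices of length at most `h` (the root is the empty list and the
leaves are the lists of length exactly `h`). -/
abbrev daryVertex (d h : ℕ) : Type := {l : List (Fin d) // l.length ≤ h}

/-- The complete `d`-ary tree of height `h`: every internal vertex has `d`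
children and every leaf is at distance `h` from the root. -/
def daryTree (d h : ℕ) : SimpleGraph (daryVertex d h) :=
  SimpleGraph.fromRel (fun x y => ∃ a : Fin d, y.1 = a :: x.1)

/-- `HasPathDecomp G w` means `G` has a path decomposition of width at most `w`:
a sequence of bags covering all vertices and edges, where the bags containing a
fixed vertex form a contiguous interval and each bag has at most `w + 1`
vertices.  Thus `HasPathDecomp G w` says that the pathwidth of `G` is at
most `w`. -/
def HasPathDecomp {V : Type*} (G : SimpleGraph V) (w : ℕ) : Prop :=
  ∃ (n : ℕ) (B : Fin n → Finset V),
    (∀ v : V, ∃ i, v ∈ B i) ∧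
    (∀ ⦃u v : V⦄, G.Adj u v → ∃ i, u ∈ B i ∧ v ∈ B i) ∧
    (∀ (v : V) (i j k : Fin n), i ≤ j → j ≤ k → v ∈ B i → v ∈ B k → v ∈ B j) ∧
    (∀ i, (B i).card ≤ w + 1)


namespace TriTree

/-- Infinite tree of triangles: `(l, false)` is the top vertex of the triangle at node `l`,
`(a :: l, true)` are its two bottom vertices. -/
def G0 : SimpleGraph (List Bool × Bool) :=
  SimpleGraph.fromRel (fun x y =>
    (x.2 = true ∧ y = (x.1, false)) ∨
    (x.2 = false ∧ ∃ a : Bool, y = (a :: x.1, true)) ∨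
    (∃ (a : Bool) (l : List Bool), x = (a :: l, true) ∧ y = ((!a) :: l, true)))

/-- A list containing all the neighbours. -/
def nbrs : List Bool × Bool → Finset (List Bool × Bool)
  | (l, false) => {(l, true), (true :: l, true), (false :: l, true)}
  | ([], true) => {([], false)}
  | (a :: l, true) => {(a :: l, false), (l, false), ((!a) :: l, true)}

lemma nbrs_card (x : List Bool × Bool) : (nbrs x).card ≤ 3 := by
  rcases x with ⟨_ | ⟨a, l⟩, _ | _⟩ <;> simp only [nbrs]
  · exact Finset.card_le_three
  · simp
  · exact Finset.card_le_three
  · exact Finset.card_le_three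

lemma mem_nbrs {x y : List Bool × Bool} (h : G0.Adj x y) : y ∈ nbrs x := by
  rw [G0, SimpleGraph.fromRel_adj] at h
  obtain ⟨x, i⟩ := x
  obtain ⟨y, j⟩ := y
  obtain ⟨-, (⟨h1, h2⟩ | ⟨h1, a, h2⟩ | ⟨a, l, h1, h2⟩) | (⟨h1, h2⟩ | ⟨h1, a, h2⟩ | ⟨a, l, h1, h2⟩)⟩ := h
  · simp only [Prod.mk.injEq] at h1 h2
    obtain ⟨rfl, rfl⟩ := h2
    subst h1
    rcases y with _ | ⟨a, l⟩ <;> simp [nbrs]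
  · simp only [Prod.mk.injEq] at h1 h2
    obtain ⟨rfl, rfl⟩ := h2
    subst h1
    cases a <;> simp [nbrs]
  · simp only [Prod.mk.injEq] at h1 h2
    obtain ⟨rfl, rfl⟩ := h2
    obtain ⟨rfl, rfl⟩ := h1
    simp [nbrs]
  · simp only [Prod.mk.injEq] at h1 h2
    obtain ⟨rfl, rfl⟩ := h2
    subst h1
    simp [nbrs]
  · simp only [Prod.mk.injEq] at h1 h2
    obtain ⟨rfl, rfl⟩ := h2
    subst h1
    simp [nbrs]
  · simp only [Prod.mk.injEq] at h1 h2
    obtain ⟨rfl, rfl⟩ := h2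
    obtain ⟨rfl, rfl⟩ := h1
    simp [nbrs]

/-- Vertices met when going up from node `x ++ s` to just below node `s`. -/
def E (s : List Bool) : List Bool → List (List Bool × Bool)
  | [] => []
  | a :: x => (a :: x ++ s, false) :: (a :: x ++ s, true) :: E s x

lemma E_append (s x y : List Bool) : E s (x ++ y) = E (y ++ s) x ++ E s y := by
  induction x with
  | nil => simp [E]
  | cons a x ih => simp [E, ih]

lemma E_length (s x : List Bool) : (E s x).length = 2 * x.length := by
  induction x with
  | nil => simp [E]
  | cons a x ih => simp [E, ih]; ring

lemma mem_E {s x : List Bool} {v : List Bool × Bool} (h : v ∈ E s x) :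
    ∃ y, y ≠ [] ∧ y <:+ x ∧ v.1 = y ++ s := by
  induction x with
  | nil => simp [E] at h
  | cons a x ih =>
    simp only [E, List.mem_cons] at h
    rcases h with rfl | rfl | h
    · exact ⟨a :: x, by simp, List.suffix_rfl, rfl⟩
    · exact ⟨a :: x, by simp, List.suffix_rfl, rfl⟩
    · obtain ⟨y, h1, h2, h3⟩ := ih h
      exact ⟨y, h1, h2.trans (List.suffix_cons a x), h3⟩

lemma E_nodup (s x : List Bool) : (E s x).Nodup := by
  induction x with
  | nil => simp [E]
  | cons a x ih =>
    have key : ∀ i, ((a :: x ++ s, i) : List Bool × Bool) ∉ E s x := by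
      intro i hi
      obtain ⟨y, -, h2, h3⟩ := mem_E hi
      have := h2.length_le
      have := congrArg List.length h3
      simp at this
      omega
    simp only [E, List.nodup_cons, List.mem_cons, not_or]
    exact ⟨⟨by simp, key _⟩, key _, ih⟩

lemma adj_flag (l : List Bool) : G0.Adj (l, false) (l, true) := by
  simp [G0, SimpleGraph.fromRel_adj]

lemma adj_up (a : Bool) (l : List Bool) : G0.Adj (a :: l, true) (l, false) := by
  cases a <;> simp [G0, SimpleGraph.fromRel_adj]

lemma adj_sib (a : Bool) (l : List Bool) : G0.Adj (a :: l, true) ((!a) :: l, true) := by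
  cases a <;> simp [G0, SimpleGraph.fromRel_adj]

lemma E_chain (s x : List Bool) : (E s x).IsChain G0.Adj := by
  induction x with
  | nil => simp [E]
  | cons a x ih =>
    cases x with
    | nil => simp [E, adj_flag]
    | cons b x =>
      simp only [E, List.isChain_cons_cons] at ih ⊢
      exact ⟨adj_flag _, adj_up _ _, ih⟩

lemma E_last (s x : List Bool) (a : Bool) :
    E s (x ++ [a]) = (E (a :: s) x ++ [(a :: s, false)]) ++ [(a :: s, true)] := by
  rw [E_append]; simp [E]

lemma path_chain (s x y : List Bool) (a : Bool) :
    (E s (x ++ [a]) ++ (E s (y ++ [!a])).reverse).IsChain G0.Adj := by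
  rw [List.isChain_append]
  refine ⟨E_chain _ _, ?_, ?_⟩
  · rw [List.isChain_reverse]
    exact (E_chain _ _).imp (fun _ _ h => h.symm)
  · rw [E_last, E_last]
    simp [adj_sib]

lemma path_nodup (s x y : List Bool) (a : Bool) :
    (E s (x ++ [a]) ++ (E s (y ++ [!a])).reverse).Nodup := by
  rw [List.nodup_append']
  refine ⟨E_nodup _ _, by simpa using E_nodup _ _, ?_⟩
  have key : ∀ (b : Bool) (z : List Bool) (v), v ∈ E s (z ++ [b]) → ∃ w, v.1 = w ++ b :: s := by
    intro b z v hv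
    rw [E_append, List.mem_append] at hv
    rcases hv with hv | hv
    · obtain ⟨w, -, -, h⟩ := mem_E hv
      exact ⟨w, by simpa using h⟩
    · simp only [E, List.mem_cons] at hv
      refine ⟨[], ?_⟩
      rcases hv with rfl | rfl | hv <;> simp_all
  intro v h1 h2
  rw [List.mem_reverse] at h2
  obtain ⟨w, hw⟩ := key _ _ _ h1
  obtain ⟨w', hw'⟩ := key _ _ _ h2
  rw [hw] at hw'
  have := (List.append_inj' hw' (by simp)).2
  cases a <;> simp at this

lemma exists_split : ∀ (_r l l' : List Bool), l.length = l'.length → l ≠ l' →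
    ∃ s x y a, l = x ++ a :: s ∧ l' = y ++ (!a) :: s := by
  intro _ l l' hl hne
  induction l generalizing l' with
  | nil => cases l' <;> simp_all
  | cons b l ih =>
    cases l' with
    | nil => simp at hl
    | cons b' l' =>
      by_cases h : l = l'
      · subst h
        refine ⟨l, [], [], b, rfl, ?_⟩
        cases b <;> cases b' <;> simp_all
      · obtain ⟨s, x, y, a, h1, h2⟩ := ih l' (by simpa using hl) h
        exact ⟨s, b :: x, b' :: y, a, by simp [h1], by simp [h2]⟩

lemma exists_walk {V : Type} (G : SimpleGraph V) (l : List V) (u : V)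
    (h : (u :: l).IsChain G.Adj) : ∃ (v : V) (p : G.Walk u v), p.support = u :: l := by
  induction l generalizing u with
  | nil => exact ⟨u, .nil, rfl⟩
  | cons w l ih =>
    rw [List.isChain_cons_cons] at h
    obtain ⟨v, p, hp⟩ := ih w h.2
    exact ⟨v, .cons h.1 p, by simp [hp]⟩

lemma exists_h (c : ℕ) : ∃ h : ℕ, (2 * h + 1) ^ c < 2 ^ h := by
  have ht := tendsto_pow_const_div_const_pow_of_one_lt c (r := (2 : ℝ)) (by norm_num)
  have h3 : (0 : ℝ) < (3 ^ c)⁻¹ := by positivity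
  obtain ⟨n, hn, hn1⟩ := ((ht.eventually_lt_const h3).and (Filter.eventually_ge_atTop 1)).exists
  refine ⟨n, ?_⟩
  rw [div_lt_iff₀ (by positivity), inv_mul_eq_div, lt_div_iff₀ (by positivity)] at hn
  have h4 : n ^ c * 3 ^ c < 2 ^ n := by exact_mod_cast hn
  calc (2 * n + 1) ^ c ≤ (n * 3) ^ c := Nat.pow_le_pow_left (by omega) c
    _ = n ^ c * 3 ^ c := mul_pow _ _ _
    _ < _ := h4

lemma exists_perm (c h : ℕ) (hh : (2 * h + 1) ^ c < 2 ^ h) (f : List Bool × Bool → Fin c) :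
    ∃ l l' : List Bool, l.length = h ∧ l'.length = h ∧ l ≠ l' ∧
      ((E [] l).map f).Perm ((E [] l').map f) := by
  let F : (List.Vector Bool h) → (Fin c → Fin (2 * h + 1)) := fun l i =>
    ⟨((E [] l.1).map f).count i, by
      have := List.count_le_length (a := i) (l := (E [] l.1).map f)
      rw [List.length_map, E_length, l.2] at this
      omega⟩
  obtain ⟨l, l', hne, hF⟩ := Fintype.exists_ne_map_eq_of_card_lt F (by
    simpa using hh)
  refine ⟨l.1, l'.1, l.2, l'.2, fun h => hne (Subtype.ext h), ?_⟩
  rw [List.perm_iff_count]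
  intro i
  simpa [F] using congrArg Fin.val (congrFun hF i)

end TriTree

open TriTree in
/-- Anagram-free vertex colouring is not bounded by maximum
degree 3: for every positive integer `c` there is a finite simple graph of
maximum degree at most `3` with no anagram-free vertex colouring using at most
`c` colours. -/
theorem anagramFree_chromatic_unbounded_maxDegree_three :
    ∀ c : ℕ, 0 < c →
      ∃ (V : Type) (G : SimpleGraph V), Finite V ∧
        (∀ v : V, (G.neighborSet v).ncard ≤ 3) ∧
        ∀ f : V → Fin c, ¬ AnagramFreeVC G f := by
  
  intro c hc
  obtain ⟨h, hh⟩ := exists_h c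
  let S : Set (List Bool × Bool) := {x | x.1.length ≤ h}
  have hS : S.Finite := by
    have : S = {l : List Bool | l.length ≤ h} ×ˢ Set.univ := by ext; simp [S]
    rw [this]
    exact (List.finite_length_le Bool h).prod Set.finite_univ
  refine ⟨S, G0.induce S, hS.to_subtype, ?_, ?_⟩
  · intro v
    have h1 : Subtype.val '' ((G0.induce S).neighborSet v) ⊆ (nbrs v.1 : Set _) := by
      rintro _ ⟨w, hw, rfl⟩
      exact mem_nbrs hw
    rw [← Set.ncard_image_of_injective _ Subtype.val_injective]
    refine (Set.ncard_le_ncard h1 (Finset.finite_toSet _)).trans ?_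
    rw [Set.ncard_coe_finset]
    exact nbrs_card _
  · intro f hf
    classical
    let f' : List Bool × Bool → Fin c := fun x => if hx : x ∈ S then f ⟨x, hx⟩ else ⟨0, hc⟩
    obtain ⟨l, l', hl, hl', hne, hp⟩ := exists_perm c h hh f'
    obtain ⟨s, x, y, a, rfl, rfl⟩ := exists_split [] l l' (hl.trans hl'.symm) hne
    have e1 : ∀ (z : List Bool) (b : Bool),
        E [] (z ++ b :: s) = E s (z ++ [b]) ++ E [] s := by
      intro z b
      have := E_append [] (z ++ [b]) s
      simpa using this
    rw [e1, e1, List.map_append, List.map_append, List.perm_append_right_iff] at hp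
    have hc := path_chain s x y a
    have hn := path_nodup s x y a
    have hmem : ∀ v ∈ E s (x ++ [a]) ++ (E s (y ++ [!a])).reverse, v ∈ S := by
      intro v hv
      rw [List.mem_append, List.mem_reverse] at hv
      simp only [List.length_append, List.length_cons] at hl hl'
      rcases hv with hv | hv <;>
      · obtain ⟨w, -, h2, h3⟩ := mem_E hv
        have := h2.length_le
        simp only [S, Set.mem_ofPred_eq, h3]
        simp at this ⊢
        omega
    have hne1 : E s (x ++ [a]) ≠ [] := by rw [E_last]; simp
    obtain ⟨u, t, hut⟩ : ∃ u t, E s (x ++ [a]) ++ (E s (y ++ [!a])).reverse = u :: t :=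
      List.exists_cons_of_ne_nil (by simp [hne1])
    rw [hut] at hc
    obtain ⟨v, p, hps⟩ := exists_walk G0 t u hc
    rw [← hut] at hps
    rw [← hps] at hn hmem
    have hval : (p.induce S hmem).support.map Subtype.val = p.support := by
      rw [SimpleGraph.Walk.support_induce, List.map_attachWith]
      exact List.attach_map_subtype_val _
    refine hf (p.induce S hmem) ?_ ?_
    · rw [SimpleGraph.Walk.isPath_def]
      refine List.Nodup.of_map Subtype.val ?_
      rwa [hval]
    · have e2 : (p.induce S hmem).support.map f = p.support.map f' := by
        have : f = f' ∘ Subtype.val := by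
          funext z
          simp [f']
        rw [this, ← List.map_map, hval]
      rw [e2, hps, List.map_append]
      refine ⟨_, _, by simpa using hne1, ?_, rfl⟩
      rw [List.map_reverse]
      exact hp.trans (List.reverse_perm _).symm
end

section
/- Anagram-free edge colouring is not bounded by maximum degree on trees: for every positive integer c there exists a tree T with maximum degree at most 3 such that T has no anagram-free edge colouring using at most c colours. In particular, for every c ≥ 1, if h is a positive integer with 2^h > (h+1)^c, then every edge c-colouring of the complete binary tree of height h contains a path whose edge colour sequence is an anagram. -/
namespace AnagramTree

/-- Truncation of a list to a vertex of the tree. -/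
def tau (h : ℕ) (l : List (Fin 2)) : daryVertex 2 h :=
  ⟨l.take h, by simp⟩

lemma tau_val {h : ℕ} {l : List (Fin 2)} (hl : l.length ≤ h) : (tau h l).1 = l := by
  simp [tau, hl]

lemma tau_self {h : ℕ} (x : daryVertex 2 h) : tau h x.1 = x :=
  Subtype.ext (tau_val x.2)

/-- The colour word read from `p ++ s` up to `s`. -/
def word {C : Type*} {h : ℕ} (f : Sym2 (daryVertex 2 h) → C) :
    List (Fin 2) → List (Fin 2) → List C
  | [], _ => []
  | a :: p, s => f s(tau h (a :: (p ++ s)), tau h (p ++ s)) :: word f p s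

lemma word_length {C : Type*} {h : ℕ} (f : Sym2 (daryVertex 2 h) → C) (p s : List (Fin 2)) :
    (word f p s).length = p.length := by
  induction p with
  | nil => rfl
  | cons a p ih => simp [word, ih]

lemma word_append {C : Type*} {h : ℕ} (f : Sym2 (daryVertex 2 h) → C) (p s : List (Fin 2)) :
    word f (p ++ s) [] = word f p s ++ word f s [] := by
  induction p with
  | nil => rfl
  | cons a p ih => simp [word, ih]

lemma adj_cons {h : ℕ} (a : Fin 2) (l : List (Fin 2)) (hl : (a :: l).length ≤ h) :
    (daryTree 2 h).Adj (tau h (a :: l)) (tau h l) := by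
  have hl' : l.length ≤ h := by simp at hl; omega
  rw [daryTree, SimpleGraph.fromRel_adj]
  refine ⟨fun e => ?_, Or.inr ⟨a, by rw [tau_val hl, tau_val hl']⟩⟩
  have := congrArg Subtype.val e
  rw [tau_val hl, tau_val hl'] at this
  simpa using congrArg List.length this

lemma exists_up {C : Type*} {h : ℕ} (f : Sym2 (daryVertex 2 h) → C) (p s : List (Fin 2))
    (hl : (p ++ s).length ≤ h) :
    ∃ w : (daryTree 2 h).Walk (tau h (p ++ s)) (tau h s), w.IsPath ∧
      (∀ x ∈ w.support, ∃ q, q <:+ p ∧ x.1 = q ++ s) ∧ w.edges.map f = word f p s := by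
  induction p with
  | nil =>
    refine ⟨SimpleGraph.Walk.nil, SimpleGraph.Walk.IsPath.nil, ?_, rfl⟩
    intro x hx
    simp at hx
    subst hx
    exact ⟨[], by simp, by simpa using tau_val (by simpa using hl)⟩
  | cons a p ih =>
    have hl' : (p ++ s).length ≤ h := by simp at hl ⊢; omega
    obtain ⟨w, hw, hs, he⟩ := ih hl'
    refine ⟨SimpleGraph.Walk.cons (adj_cons a (p ++ s) hl) w, ?_, ?_, ?_⟩
    · rw [SimpleGraph.Walk.cons_isPath_iff]
      refine ⟨hw, fun hm => ?_⟩
      obtain ⟨q, hq, e⟩ := hs _ hm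
      rw [tau_val (by simpa using hl)] at e
      have := congrArg List.length e
      have := hq.length_le
      simp at *
      omega
    · intro x hx
      rw [SimpleGraph.Walk.support_cons, List.mem_cons] at hx
      rcases hx with rfl | hx
      · exact ⟨a :: p, List.suffix_rfl, tau_val hl⟩
      · obtain ⟨q, hq, e⟩ := hs _ hx
        exact ⟨q, hq.trans (List.suffix_cons a p), e⟩
    · simp [word, he]

lemma split_lists (l₁ l₂ : List (Fin 2)) (hlen : l₁.length = l₂.length) (hne : l₁ ≠ l₂) :
    ∃ q₁ q₂ s a b, a ≠ b ∧ l₁ = (q₁ ++ [a]) ++ s ∧ l₂ = (q₂ ++ [b]) ++ s := by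
  induction l₁ generalizing l₂ with
  | nil => cases l₂ <;> simp_all
  | cons x t ih =>
    cases l₂ with
    | nil => simp at hlen
    | cons y u =>
      by_cases e : t = u
      · subst e
        exact ⟨[], [], t, x, y, fun e => hne (by rw [e]), rfl, rfl⟩
      · obtain ⟨q₁, q₂, s, a, b, hab, h1, h2⟩ := ih u (by simpa using hlen) e
        exact ⟨x :: q₁, y :: q₂, s, a, b, hab, by simp [h1], by simp [h2]⟩

lemma suffix_snoc {q r : List (Fin 2)} {a : Fin 2} (hq : q <:+ r ++ [a]) :
    q = [] ∨ q.getLast? = some a := by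
  rcases List.eq_nil_or_concat q with rfl | ⟨q', b, rfl⟩
  · exact Or.inl rfl
  · right
    obtain ⟨t, ht⟩ := hq
    have := congrArg List.getLast? ht
    simpa [← List.append_assoc] using this

lemma path_of_perm {C : Type*} {h : ℕ} (f : Sym2 (daryVertex 2 h) → C) (l₁ l₂ : List (Fin 2))
    (h1 : l₁.length = h) (h2 : l₂.length = h) (hne : l₁ ≠ l₂)
    (hp : (word f l₁ []).Perm (word f l₂ [])) :
    ∃ (u v : daryVertex 2 h) (p : (daryTree 2 h).Walk u v),
      p.IsPath ∧ IsAnagram (p.edges.map f) := by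
  obtain ⟨q₁, q₂, s, a, b, hab, e1, e2⟩ := split_lists l₁ l₂ (h1.trans h2.symm) hne
  obtain ⟨w₁, hw₁, hs₁, he₁⟩ := exists_up f (q₁ ++ [a]) s (by rw [← e1, h1])
  obtain ⟨w₂, hw₂, hs₂, he₂⟩ := exists_up f (q₂ ++ [b]) s (by rw [← e2, h2])
  rw [e1, e2, word_append, word_append, List.perm_append_right_iff] at hp
  refine ⟨_, _, w₁.append w₂.reverse, ?_, word f (q₁ ++ [a]) s,
    (word f (q₂ ++ [b]) s).reverse, ?_, hp.trans (List.reverse_perm _).symm, ?_⟩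
  · have hsl : s.length ≤ h := by
      have := congrArg List.length e1
      simp at this
      omega
    have hn := hw₂.reverse.support_nodup
    rw [← SimpleGraph.Walk.cons_tail_support, List.nodup_cons] at hn
    rw [SimpleGraph.Walk.isPath_def, SimpleGraph.Walk.support_append, List.nodup_append]
    refine ⟨hw₁.support_nodup, hn.2, ?_⟩
    rintro x hx y hy rfl
    obtain ⟨r₁, hr₁, x1⟩ := hs₁ x hx
    obtain ⟨r₂, hr₂, x2⟩ := hs₂ x (by
      have := List.mem_of_mem_tail hy
      simpa using this)
    have hr : r₁ = r₂ := by
      rw [x1] at x2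
      exact List.append_cancel_right x2
    subst hr
    rcases suffix_snoc hr₁ with hh | hh
    · subst hh
      apply hn.1
      have : x = tau h s := Subtype.ext (by rw [tau_val hsl, x1]; rfl)
      exact Eq.subst (motive := fun z => z ∈ w₂.reverse.support.tail) this hy
    · rcases suffix_snoc hr₂ with hh' | hh'
      · simp [hh'] at hh
      · rw [hh] at hh'
        exact hab (by simpa using hh')
  · intro hh
    have := congrArg List.length hh
    rw [word_length] at this
    simp at this
  · rw [SimpleGraph.Walk.edges_append, SimpleGraph.Walk.edges_reverse, List.map_append,
      List.map_reverse, he₁, he₂]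

lemma main (c h : ℕ) (hc : (h + 1) ^ c < 2 ^ h) (f : Sym2 (daryVertex 2 h) → Fin c) :
    ∃ (u v : daryVertex 2 h) (p : (daryTree 2 h).Walk u v),
      p.IsPath ∧ IsAnagram (p.edges.map f) := by
  let F : (Fin h → Fin 2) → (Fin c → Fin (h + 1)) := fun g i =>
    ⟨(word f (List.ofFn g) []).count i, by
      have := List.count_le_length (a := i) (l := word f (List.ofFn g) [])
      rw [word_length] at this
      simp at this
      omega⟩
  obtain ⟨g₁, g₂, hne, hF⟩ := Fintype.exists_ne_map_eq_of_card_lt F (by simpa using hc)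
  refine path_of_perm f (List.ofFn g₁) (List.ofFn g₂) (by simp) (by simp)
    (fun e => hne (List.ofFn_injective e)) ?_
  rw [List.perm_iff_count]
  intro i
  exact congrArg Fin.val (congrFun hF i)

lemma adj_iff {h : ℕ} {x y : daryVertex 2 h} : (daryTree 2 h).Adj x y ↔
    (∃ a, y.1 = a :: x.1) ∨ (∃ a, x.1 = a :: y.1) := by
  rw [daryTree, SimpleGraph.fromRel_adj]
  refine ⟨fun hh => hh.2, fun hh => ⟨?_, hh⟩⟩
  rintro rfl
  rcases hh with ⟨a, e⟩ | ⟨a, e⟩ <;> simpa using congrArg List.length e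

lemma finite_vertex (h : ℕ) : Finite (daryVertex 2 h) :=
  (List.finite_length_le (Fin 2) h).to_subtype

lemma connected (h : ℕ) : (daryTree 2 h).Connected := by
  haveI : Nonempty (daryVertex 2 h) := ⟨tau h []⟩
  have key : ∀ x : daryVertex 2 h, (daryTree 2 h).Reachable x (tau h []) := by
    intro x
    obtain ⟨w, -⟩ := exists_up (fun _ => ()) x.1 [] (by simpa using x.2)
    rw [List.append_nil, tau_self] at w
    exact ⟨w⟩
  exact ⟨fun x y => (key x).trans (key y).symm⟩

lemma bridge_aux {h : ℕ} {x y : daryVertex 2 h} {a : Fin 2} (e : y.1 = a :: x.1) :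
    ¬ ((daryTree 2 h).deleteEdges {s(x, y)}).Reachable x y := by
  have key : ∀ u v : daryVertex 2 h, ((daryTree 2 h).deleteEdges {s(x, y)}).Adj u v →
      (y.1 <:+ u.1 ↔ y.1 <:+ v.1) := by
    intro u v huv
    rw [SimpleGraph.deleteEdges_adj, adj_iff] at huv
    obtain ⟨huv, hn⟩ := huv
    simp only [Set.mem_singleton_iff] at hn
    rcases huv with ⟨b, hb⟩ | ⟨b, hb⟩
    · rw [hb, List.suffix_cons_iff]
      constructor
      · exact Or.inr
      · rintro (hh | hh)
        · exfalso
          apply hn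
          have h1 : y = v := Subtype.ext (hh.trans hb.symm)
          have h2 : x = u := Subtype.ext (by rw [e] at hh; exact (List.cons.inj hh).2)
          rw [h1, h2]
        · exact hh
    · rw [hb, List.suffix_cons_iff]
      constructor
      · rintro (hh | hh)
        · exfalso
          apply hn
          have h1 : y = u := Subtype.ext (hh.trans hb.symm)
          have h2 : x = v := Subtype.ext (by rw [e] at hh; exact (List.cons.inj hh).2)
          rw [h1, h2, Sym2.eq_swap]
        · exact hh
      · exact Or.inr
  rintro ⟨w⟩
  have gen : ∀ u v : daryVertex 2 h, ((daryTree 2 h).deleteEdges {s(x, y)}).Walk u v →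
      (y.1 <:+ u.1 ↔ y.1 <:+ v.1) := by
    intro u v w
    induction w with
    | nil => rfl
    | cons hh _ ih => exact (key _ _ hh).trans ih
  have := ((gen _ _ w).2 List.suffix_rfl).length_le
  simp [e] at this

lemma isTree (h : ℕ) : (daryTree 2 h).IsTree := by
  refine ⟨connected h, ?_⟩
  rw [SimpleGraph.isAcyclic_iff_forall_adj_isBridge]
  intro x y hxy
  rcases adj_iff.1 hxy with ⟨a, e⟩ | ⟨a, e⟩
  · rw [SimpleGraph.isBridge_iff]
    exact bridge_aux e
  · rw [Sym2.eq_swap, SimpleGraph.isBridge_iff]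
    exact bridge_aux e

lemma degree_le (h : ℕ) (x : daryVertex 2 h) : ((daryTree 2 h).neighborSet x).ncard ≤ 3 := by
  classical
  have hsub : (daryTree 2 h).neighborSet x ⊆
      (({tau h x.1.tail, tau h (0 :: x.1), tau h (1 :: x.1)} : Finset (daryVertex 2 h)) :
        Set (daryVertex 2 h)) := by
    intro y hy
    rw [SimpleGraph.mem_neighborSet, adj_iff] at hy
    rcases hy with ⟨a, e⟩ | ⟨a, e⟩
    · have := tau_self y
      rw [e] at this
      fin_cases a
      · simp [← this]
      · simp [← this]
    · have : tau h x.1.tail = y := by rw [e, List.tail_cons, tau_self]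
      simp [this]
  refine (Set.ncard_le_ncard hsub (Finset.finite_toSet _)).trans ?_
  rw [Set.ncard_coe_finset]
  exact Finset.card_le_three

lemma exists_height (c : ℕ) (hc : 0 < c) : ∃ h : ℕ, (h + 1) ^ c < 2 ^ h := by
  refine ⟨2 ^ (9 * c) - 1, ?_⟩
  have h1 : 2 ^ (9 * c) - 1 + 1 = 2 ^ (9 * c) := Nat.sub_add_cancel Nat.one_le_two_pow
  rw [h1, ← pow_mul]
  apply Nat.pow_lt_pow_right (by norm_num)
  have h2 : 3 * c + 1 ≤ 2 ^ (3 * c) := Nat.lt_two_pow_self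
  have h3 : (3 * c + 1) ^ 3 ≤ 2 ^ (9 * c) := by
    calc (3 * c + 1) ^ 3 ≤ (2 ^ (3 * c)) ^ 3 := Nat.pow_le_pow_left h2 3
      _ = 2 ^ (9 * c) := by rw [← pow_mul]; congr 1; ring
  have h4 : 9 * c * c + 1 < (3 * c + 1) ^ 3 := by
    have : (3 * c + 1) ^ 3 = 27 * c ^ 3 + 27 * c ^ 2 + 9 * c + 1 := by ring
    rw [this]
    have : 9 * c * c = 9 * c ^ 2 := by ring
    rw [this]
    omega
  omega

end AnagramTree

/-- Anagram-free edge colouring is unbounded on trees of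
maximum degree 3: for every positive `c` there is a tree with maximum degree at
most `3` with no anagram-free edge colouring using at most `c` colours.
Moreover, for every `c ≥ 1` and every positive `h` with `2^h > (h+1)^c`, every
edge `c`-colouring of the complete binary tree of height `h` contains a path
whose edge colour sequence is an anagram. -/
theorem anagramFree_chromatic_index_unbounded_on_trees :
    (∀ c : ℕ, 0 < c →
      ∃ (V : Type) (G : SimpleGraph V), Finite V ∧ G.IsTree ∧
        (∀ v : V, (G.neighborSet v).ncard ≤ 3) ∧
        ∀ f : Sym2 V → Fin c, ¬ AnagramFreeEC G f) ∧
    (∀ c h : ℕ, 0 < c → 0 < h → (h + 1) ^ c < 2 ^ h →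
      ∀ f : Sym2 (daryVertex 2 h) → Fin c,
        ∃ (u v : daryVertex 2 h) (p : (daryTree 2 h).Walk u v),
          p.IsPath ∧ IsAnagram (p.edges.map f)) := by
  refine ⟨fun c hc => ?_, fun c h _ _ hh f => AnagramTree.main c h hh f⟩
  obtain ⟨h, hh⟩ := AnagramTree.exists_height c hc
  refine ⟨daryVertex 2 h, daryTree 2 h, AnagramTree.finite_vertex h, AnagramTree.isTree h,
    AnagramTree.degree_le h, fun f hf => ?_⟩
  obtain ⟨u, v, p, hp, ha⟩ := AnagramTree.main c h hh f
  exact hf p hp ha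
end

section
/- Trees have unbounded anagram-free chromatic number: for every positive integer c there exists a tree T such that T has no anagram-free vertex colouring using at most c colours. -/
section Helpers

/-- `y` is a child of `x` in the complete `d`-ary tree. -/
def IsChild {d h : ℕ} (x y : daryVertex d h) : Prop := ∃ a : Fin d, y.1 = a :: x.1

lemma IsChild.adj {d h : ℕ} {x y : daryVertex d h} (hc : IsChild x y) : (daryTree d h).Adj x y := by
  unfold daryTree
  rw [SimpleGraph.fromRel_adj]
  refine ⟨?_, Or.inl hc⟩
  rintro rfl
  obtain ⟨a, ha⟩ := hc
  have := congrArg List.length ha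
  simp at this

lemma daryTree_reach {d h : ℕ} : ∀ (l : List (Fin d)) (hl : l.length ≤ h),
    (daryTree d h).Reachable ⟨[], Nat.zero_le _⟩ ⟨l, hl⟩
  | [], _ => SimpleGraph.Reachable.refl _
  | a :: l, hl => by
    have hl' : l.length ≤ h := by simp at hl; omega
    have hc : IsChild (⟨l, hl'⟩ : daryVertex d h) ⟨a :: l, hl⟩ := ⟨a, rfl⟩
    exact (daryTree_reach l hl').trans hc.adj.reachable

lemma daryVertex_finite (d h : ℕ) : Finite (daryVertex d h) :=
  (List.finite_length_le (Fin d) h).to_subtype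

lemma daryTree_isTree (d h : ℕ) : (daryTree d h).IsTree := by
  have := daryVertex_finite d h
  have hconn : (daryTree d h).Connected := by
    have : Nonempty (daryVertex d h) := ⟨⟨[], Nat.zero_le _⟩⟩
    refine SimpleGraph.Connected.mk ?_
    intro x y
    exact (daryTree_reach x.1 x.2).symm.trans (daryTree_reach y.1 y.2)
  rw [SimpleGraph.isTree_iff_connected_and_card]
  refine ⟨hconn, le_antisymm ?_ hconn.card_vert_le_card_edgeSet_add_one⟩
  -- each edge is the parent edge of a non-root vertex
  have key : ∀ e : (daryTree d h).edgeSet, ∃ y : daryVertex d h, y.1 ≠ [] ∧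
      ∃ x, IsChild x y ∧ e.1 = s(x, y) := by
    rintro ⟨e, he⟩
    induction e using Sym2.ind with
    | _ x y =>
      rw [SimpleGraph.mem_edgeSet] at he
      unfold daryTree at he
      rw [SimpleGraph.fromRel_adj] at he
      rcases he.2 with ⟨a, ha⟩ | ⟨a, ha⟩
      · exact ⟨y, by simp [ha], x, ⟨a, ha⟩, rfl⟩
      · exact ⟨x, by simp [ha], y, ⟨a, ha⟩, Sym2.eq_swap⟩
  choose g hg x hx hgx using key
  let root : daryVertex d h := ⟨[], Nat.zero_le _⟩
  let F : Option (daryTree d h).edgeSet → daryVertex d h := fun o => o.elim root g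
  have hF : Function.Injective F := by
    rintro (_ | e) (_ | e') hee
    · rfl
    · exact absurd (congrArg Subtype.val hee).symm (hg e')
    · exact absurd (congrArg Subtype.val hee) (hg e)
    · have h1 : g e = g e' := hee
      obtain ⟨a, ha⟩ := hx e
      obtain ⟨b, hb⟩ := hx e'
      have h2 : x e = x e' := by
        apply Subtype.ext
        rw [h1, hb] at ha
        simpa using (List.cons.inj ha).2.symm
      congr 1
      apply Subtype.ext
      rw [hgx e, hgx e', h1, h2]
  have := Nat.card_le_card_of_injective F hF
  rwa [Finite.card_option] at this

/-- `v` is the root of a binary subtree whose levels are coloured following the given pattern. -/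
def Good {d h : ℕ} {C : Type} (f : daryVertex d h → C) : List C → daryVertex d h → Prop
  | [], _ => True
  | a :: l, v => f v = a ∧ (l = [] ∨ ∃ w₁ w₂, w₁ ≠ w₂ ∧ IsChild v w₁ ∧ IsChild v w₂ ∧
      Good f l w₁ ∧ Good f l w₂)

lemma good_exists {d h c : ℕ} (f : daryVertex d h → Fin c) (hd : ∀ n, n ≤ h → c ^ n < d) :
    ∀ (n : ℕ) (v : daryVertex d h), v.1.length + n ≤ h →
      ∃ l : List (Fin c), l.length = n + 1 ∧ Good f l v
  | 0, v, _ => ⟨[f v], rfl, rfl, Or.inl rfl⟩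
  | n + 1, v, hv => by
    have hch : ∀ a : Fin d, (a :: v.1).length ≤ h := fun a => by simp; omega
    have ih : ∀ a : Fin d, ∃ l : List (Fin c), l.length = n + 1 ∧
        Good f l ⟨a :: v.1, hch a⟩ := fun a =>
      good_exists f hd n ⟨a :: v.1, hch a⟩ (by simp; omega)
    choose P hP hG using ih
    obtain ⟨a, b, hab, hPab⟩ := Fintype.exists_ne_map_eq_of_card_lt
      (β := List.Vector (Fin c) (n + 1)) (fun a : Fin d => ⟨P a, hP a⟩)
      (by rw [card_vector]; simpa using hd (n + 1) (by omega))
    have hPab' : P a = P b := congrArg Subtype.val hPab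
    refine ⟨f v :: P a, by simp [hP], rfl, Or.inr ⟨⟨a :: v.1, hch a⟩, ⟨b :: v.1, hch b⟩, ?_,
      ⟨a, rfl⟩, ⟨b, rfl⟩, hG a, hPab' ▸ hG b⟩⟩
    intro heq
    exact hab (List.cons.inj (congrArg Subtype.val heq)).1

lemma good_descend {d h : ℕ} {C : Type} (f : daryVertex d h → C) (x : C) (t : List C) :
    ∀ (l : List C) (v : daryVertex d h), Good f (l ++ x :: t) v → ∃ u, Good f (x :: t) u
  | [], v, hv => ⟨v, hv⟩
  | a :: l, v, hv => by
    obtain ⟨_, h0 | ⟨w, _, _, _, _, hw, _⟩⟩ := hv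
    · simp at h0
    · exact good_descend f x t l w hw

lemma good_path {d h : ℕ} {C : Type} (f : daryVertex d h → C) (t : List C) :
    ∀ (s : List C) (a : C) (v : daryVertex d h), Good f (a :: s ++ t) v →
      ∃ (u : daryVertex d h) (p : (daryTree d h).Walk v u), p.IsPath ∧
        p.support.map f = a :: s ∧ ∀ z ∈ p.support, v.1 <:+ z.1
  | [], a, v, hv => ⟨v, SimpleGraph.Walk.nil, by simp, by simpa using hv.1, by simp⟩
  | b :: s, a, v, hv => by
    obtain ⟨hfv, h0 | ⟨w, _, _, hc, _, hw, _⟩⟩ := hv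
    · simp at h0
    · obtain ⟨u, p, hp, hs, hz⟩ := good_path f t s b w hw
      obtain ⟨i, hi⟩ := hc
      refine ⟨u, SimpleGraph.Walk.cons (IsChild.adj ⟨i, hi⟩) p, ?_, ?_, ?_⟩
      · rw [SimpleGraph.Walk.cons_isPath_iff]
        refine ⟨hp, fun hmem => ?_⟩
        have := (hz v hmem).length_le
        rw [hi] at this
        simp at this
      · simp [hs, hfv]
      · intro z hzm
        rw [SimpleGraph.Walk.support_cons, List.mem_cons] at hzm
        rcases hzm with rfl | hzm
        · exact List.suffix_refl _
        · refine List.IsSuffix.trans ?_ (hz z hzm)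
          rw [hi]
          exact List.suffix_cons _ _

lemma good_anagram {d h : ℕ} {C : Type} (f : daryVertex d h → C) (x : C) (s t : List C)
    (v : daryVertex d h) (hv : Good f (x :: s ++ x :: t) v) : ¬ AnagramFreeVC (daryTree d h) f := by
  intro hf
  obtain ⟨hfv, h0 | ⟨w₁, w₂, hne, hc₁, hc₂, hg₁, hg₂⟩⟩ := hv
  · simp at h0
  have hlong : ∃ (u : daryVertex d h) (p : (daryTree d h).Walk w₂ u), p.IsPath ∧
        p.support.map f = s ++ [x] ∧ ∀ z ∈ p.support, w₂.1 <:+ z.1 := by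
    cases s with
    | nil => exact good_path f t [] x w₂ hg₂
    | cons b s => exact good_path f t (s ++ [x]) b w₂ (by simpa using hg₂)
  obtain ⟨u₂, p₂, hp₂, hs₂, hz₂⟩ := hlong
  have hvlt : ∀ w : daryVertex d h, IsChild v w → ∀ z : daryVertex d h, w.1 <:+ z.1 → z ≠ v := by
    rintro w ⟨i, hi⟩ z hz rfl
    have := hz.length_le
    rw [hi] at this
    simp at this
  cases s with
  | nil =>
    refine hf (SimpleGraph.Walk.cons hc₂.adj p₂) ?_ ⟨[x], [x], by simp, List.Perm.refl _, ?_⟩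
    · rw [SimpleGraph.Walk.cons_isPath_iff]
      exact ⟨hp₂, fun hm => hvlt w₂ hc₂ v (hz₂ v hm) rfl⟩
    · simp [hs₂, hfv]
  | cons b s =>
    obtain ⟨u₁, p₁, hp₁, hs₁, hz₁⟩ := good_path f (x :: t) s b w₁ hg₁
    have hsup : (p₁.reverse.append (SimpleGraph.Walk.cons hc₁.adj.symm
        (SimpleGraph.Walk.cons hc₂.adj p₂))).support
        = p₁.support.reverse ++ v :: p₂.support := by
      rw [SimpleGraph.Walk.support_append]
      simp
    refine hf (p₁.reverse.append (SimpleGraph.Walk.cons hc₁.adj.symm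
        (SimpleGraph.Walk.cons hc₂.adj p₂))) ?_
        ⟨(b :: s).reverse ++ [x], (b :: s) ++ [x], by simp, ?_, ?_⟩
    · rw [SimpleGraph.Walk.isPath_def, hsup, List.nodup_append, List.nodup_reverse,
        List.nodup_cons]
      refine ⟨hp₁.support_nodup, ⟨fun hm => hvlt w₂ hc₂ v (hz₂ v hm) rfl, hp₂.support_nodup⟩, ?_⟩
      intro y hy z hz hyz
      subst hyz
      rw [List.mem_reverse] at hy
      rcases List.mem_cons.1 hz with hyv | hy2
      · exact hvlt w₁ hc₁ y (hz₁ y hy) hyv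
      · apply hne
        apply Subtype.ext
        obtain ⟨i, hi⟩ := hc₁
        obtain ⟨j, hj⟩ := hc₂
        exact (List.suffix_of_suffix_length_le (hz₁ y hy) (hz₂ y hy2)
          (by simp [hi, hj])).eq_of_length (by simp [hi, hj])
    · exact (List.reverse_perm _).append_right _
    · rw [hsup, List.map_append, List.map_reverse, hs₁, List.map_cons, hs₂, hfv]
      simp

end Helpers

/-- Trees have unbounded anagram-free chromatic number: for
every positive integer `c` there is a tree with no anagram-free vertex
colouring using at most `c` colours. -/
theorem anagramFree_chromatic_unbounded_on_trees :
    ∀ c : ℕ, 0 < c →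
      ∃ (V : Type) (G : SimpleGraph V), Finite V ∧ G.IsTree ∧
        ∀ f : V → Fin c, ¬ AnagramFreeVC G f := by
  intro c hc
  refine ⟨daryVertex (c ^ c + 1) c, daryTree (c ^ c + 1) c, daryVertex_finite _ _,
    daryTree_isTree _ _, fun f => ?_⟩
  obtain ⟨l, hl, hg⟩ := good_exists f
    (fun n hn => Nat.lt_succ_of_le (Nat.pow_le_pow_right hc hn)) c ⟨[], Nat.zero_le _⟩ (by simp)
  have hnd : ¬ l.Nodup := by
    intro hnd
    have := hnd.length_le_card
    simp [hl] at this
  obtain ⟨x, hx⟩ := List.exists_duplicate_iff_not_nodup.2 hnd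
  rw [List.duplicate_iff_two_le_count] at hx
  have hxm : x ∈ l := List.count_pos_iff.1 (by omega)
  obtain ⟨p, q, rfl, hxp⟩ := List.eq_append_cons_of_mem hxm
  rw [List.count_append, List.count_eq_zero_of_not_mem hxp, List.count_cons_self] at hx
  have hxq : x ∈ q := List.count_pos_iff.1 (by omega)
  obtain ⟨s, t, rfl⟩ := List.append_of_mem hxq
  obtain ⟨u, hu⟩ := good_descend f x (s ++ x :: t) p _ hg
  exact good_anagram f x s t u hu
end

section
/- Every tree T of radius h has an anagram-free vertex colouring using at most h + 1 colours; in particular, colouring each vertex by its distance from a centre of T is an anagram-free colouring. -/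
/-- In a tree, the neighbour of `b` which is closer to `v` is unique. -/
theorem tree_parent_unique {V : Type} {G : SimpleGraph V} (hG : G.IsTree) (v : V) {a b c : V}
    (hab : G.Adj a b) (hcb : G.Adj c b) (ha : G.dist v b = G.dist v a + 1)
    (hc : G.dist v b = G.dist v c + 1) : a = c := by
  obtain ⟨p, hp⟩ := hG.1.exists_walk_length_eq_dist v a
  obtain ⟨q, hq⟩ := hG.1.exists_walk_length_eq_dist v c
  have h1 : (p.concat hab).IsPath := by
    apply SimpleGraph.Walk.isPath_of_length_eq_dist
    rw [SimpleGraph.Walk.length_concat]; omega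
  have h2 : (q.concat hcb).IsPath := by
    apply SimpleGraph.Walk.isPath_of_length_eq_dist
    rw [SimpleGraph.Walk.length_concat]; omega
  have h3 := (hG.existsUnique_path v b).unique h1 h2
  have h4 := congrArg SimpleGraph.Walk.penultimate h3
  simpa using h4

/-- A path which starts by moving away from `v` keeps moving away from `v`. -/
theorem tree_path_increasing {V : Type} {G : SimpleGraph V} (hG : G.IsTree) (v : V) {b w : V}
    (q : G.Walk b w) : ∀ {a : V} (h : G.Adj a b), (SimpleGraph.Walk.cons h q).IsPath →
      G.dist v a < G.dist v b → ∀ x ∈ q.support, G.dist v a < G.dist v x := by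
  induction q with
  | nil =>
    intro a h hp hlt x hx
    simp at hx
    subst hx
    exact hlt
  | @cons b c w h' q ih =>
    intro a h hp hlt x hx
    have hab := hG.dist_eq_dist_add_one_of_adj v h
    have hbc := hG.dist_eq_dist_add_one_of_adj v h'
    have hne : a ≠ c := by
      rintro rfl
      rw [SimpleGraph.Walk.cons_isPath_iff] at hp
      apply hp.2
      simp
    have hlt' : G.dist v b < G.dist v c := by
      by_contra hcon
      exact hne (tree_parent_unique hG v h h'.symm (by omega) (by omega))
    rw [SimpleGraph.Walk.support_cons, List.mem_cons] at hx
    rcases hx with rfl | hx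
    · exact hlt
    · exact hlt.trans (ih h' hp.of_cons hlt' x hx)

/-- On every path of a tree the minimum distance to `v` is attained exactly once. -/
theorem tree_path_min {V : Type} {G : SimpleGraph V} (hG : G.IsTree) (v : V) {a w : V}
    (p : G.Walk a w) (hp : p.IsPath) :
    ∃ m, (∀ x ∈ p.support, m ≤ G.dist v x) ∧
      (p.support.map (fun u => G.dist v u)).count m = 1 := by
  induction p with
  | @nil u => exact ⟨G.dist v u, by simp, by simp⟩
  | @cons a b w h q ih =>
    have hab := hG.dist_eq_dist_add_one_of_adj v h
    by_cases hlt : G.dist v a < G.dist v b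
    · have key := tree_path_increasing hG v q h hp hlt
      refine ⟨G.dist v a, ?_, ?_⟩
      · intro x hx
        rw [SimpleGraph.Walk.support_cons, List.mem_cons] at hx
        rcases hx with rfl | hx
        · exact le_rfl
        · exact (key x hx).le
      · rw [SimpleGraph.Walk.support_cons, List.map_cons, List.count_cons_self,
          List.count_eq_zero_of_not_mem]
        intro hmem
        obtain ⟨x, hx, he⟩ := List.mem_map.1 hmem
        have := key x hx
        omega
    · obtain ⟨m, hm, hc⟩ := ih hp.of_cons
      have hb := hm b q.start_mem_support
      refine ⟨m, ?_, ?_⟩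
      · intro x hx
        rw [SimpleGraph.Walk.support_cons, List.mem_cons] at hx
        rcases hx with rfl | hx
        · omega
        · exact hm x hx
      · rw [SimpleGraph.Walk.support_cons, List.map_cons, List.count_cons_of_ne, hc]
        omega

/-- Every tree of radius `h` has an anagram-free vertex
colouring with at most `h + 1` colours; in particular colouring every vertex
by its distance from a centre `v` is anagram-free. -/
theorem anagramFree_chromatic_le_radius_succ {V : Type} [Finite V]
    (G : SimpleGraph V) (hG : G.IsTree) (h : ℕ) (v : V)
    (hcentre : ∀ u : V, G.dist v u ≤ h) :
    AnagramFreeVC G (fun u => G.dist v u) ∧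
    ∃ f : V → Fin (h + 1), AnagramFreeVC G f := by
  have main : AnagramFreeVC G (fun u => G.dist v u) := by
    rintro a b p hp ⟨w₁, w₂, -, hperm, heq⟩
    obtain ⟨m, -, hc⟩ := tree_path_min hG v p hp
    rw [heq, List.count_append, hperm.count_eq] at hc
    omega
  refine ⟨main, fun u => ⟨G.dist v u, Nat.lt_succ_of_le (hcentre u)⟩, ?_⟩
  rintro a b p hp ⟨w₁, w₂, hne, hperm, heq⟩
  refine main p hp ⟨w₁.map Fin.val, w₂.map Fin.val, by simpa using hne, hperm.map _, ?_⟩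
  rw [← List.map_append, ← heq, List.map_map]
  rfl
end

section
/- Every tree T of pathwidth m has an anagram-free vertex colouring using at most 4m + 1 colours; that is, φ(T) ≤ 4·pw(T) + 1 for every tree T. -/
/-- Letters of the 85-letter Keränen word, two bits each. -/
def kW : ℕ := 227193366226236800249709662197971513346990172696100

/-- Prefix letter counts of the Keränen word, one byte each. -/
def kT : ℕ := 192364792585579514640223809849697484116132052463140566022981331987653499662749155874347004496197567646596614450527379343904291950343051804972197406657814754241722331008165431918390451896185942433326810165211990336946259868021058854086827658918636917278056683327725632645293172446758366037724095801240147987117323856713675450263634845441301482476592910478378237425481771152863178510538594746988780140890515456425177863420900285503534831040448532469126576815643370095960147020582166169077439761816755368873902139218346621616794069593905061301556655047428192562167041251289838740477499449482555247927593012827901340690103387790469925043659920898771380443352811993422474153526606035637956930904306804825398566205155807184012263102421708206255320121381957091195520017836053958863875339211200212058441848727891372822684217057162035200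

/-- Weighted prefix counts modulo 43435, sixteen bits each. -/
def kR : ℕ := 16678140587562454727140714713838307556352480666437462082247185356893892720522314006501206929490164468635559639262820556692125608651874734537299283749178457738216435634336750066738576326541971780390674437726458185950347080962327521340604923955132854900315212252109531624282910282503514380379470367707251525134860628022340393563097885933688823401726908973481575206334026693720209266424263622895156955245029949440

def kLam : Fin 4 → ℕ := ![1, 30176, 19636, 39101]

/-- The `i`-th letter of the Keränen word. -/
def kw (i : ℕ) : ℕ := (kW >>> (2 * i)) % 4

/-- Number of letters `x` among the first `i` letters of the Keränen word. -/
def kP (i : ℕ) (x : Fin 4) : ℕ := (kT >>> (8 * (4 * i + x.val))) % 256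

def kRes (i : ℕ) : ℕ := (kR >>> (16 * i)) % 65536

def allBelow : ℕ → (ℕ → Bool) → Bool
  | 0, _ => true
  | n + 1, f => f n && allBelow n f

theorem allBelow_spec {n : ℕ} {f : ℕ → Bool} (h : allBelow n f = true) :
    ∀ i < n, f i = true := by
  induction n with
  | zero => intro i hi; omega
  | succ n ih =>
    rw [allBelow, Bool.and_eq_true] at h
    intro i hi
    rcases Nat.lt_succ_iff_lt_or_eq.mp hi with h1 | h1
    · exact ih h.2 i h1
    · rw [h1]; exact h.1

def kExc (a c : Fin 4) (i j k : ℕ) : Prop :=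
  ∃ d1 d2 d3 : Fin 2, ∀ x : Fin 4,
    kP i (x - a) + kP k (x - c) + 2 * d2.val * kP 85 x
      = 2 * kP j x + d1.val * kP 85 (x - a) + d3.val * kP 85 (x - c)

instance (a c : Fin 4) (i j k : ℕ) : Decidable (kExc a c i j k) := by
  unfold kExc; infer_instance

def kChk (a c : Fin 4) (i j k : ℕ) : Bool :=
  bif Nat.beq ((kLam a * kRes i + kLam c * kRes k) % 43435) ((2 * kRes j) % 43435)
  then decide (kExc a c i j k) else true

set_option maxRecDepth 100000 in
theorem kChk_all : ∀ a c : Fin 4,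
    allBelow 85 (fun i => allBelow 85 (fun j => kChk a c i j ((2 * j + 85 - i) % 85))) = true := by
  decide +kernel

theorem kP_zero : ∀ x : Fin 4, kP 0 x = 0 := by decide +kernel

theorem kP_succ : ∀ i < 85, ∀ x : Fin 4,
    kP (i + 1) x = kP i x + if kw i = x.val then 1 else 0 := by decide +kernel

theorem kP_85 : kP 85 0 = 19 ∧ kP 85 1 = 21 ∧ kP 85 2 = 27 ∧ kP 85 3 = 18 := by decide +kernel

theorem kRes_spec : ∀ i < 85, ∀ a : Fin 4,
    (kLam 0 * kP i (0 - a) + kLam 1 * kP i (1 - a) + kLam 2 * kP i (2 - a) + kLam 3 * kP i (3 - a))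
      % 43435 = (kLam a * kRes i) % 43435 := by decide +kernel

/-- Prefix counts of the image of the two-letter word `0 c`. -/
def kQ (c : Fin 4) (n : ℕ) (x : Fin 4) : ℕ :=
  bif Nat.blt n 85 then kP n x else kP 85 x + kP (n - 85) (x - c)

def kBlk (c : Fin 4) (i j : ℕ) : Bool :=
  bif Nat.blt i j && Nat.blt (2 * j) (170 + i) then
    !(Nat.beq (kQ c i 0 + kQ c (2 * j - i) 0) (2 * kQ c j 0)
      && Nat.beq (kQ c i 1 + kQ c (2 * j - i) 1) (2 * kQ c j 1)
      && Nat.beq (kQ c i 2 + kQ c (2 * j - i) 2) (2 * kQ c j 2)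
      && Nat.beq (kQ c i 3 + kQ c (2 * j - i) 3) (2 * kQ c j 3))
  else true

set_option maxRecDepth 100000 in
theorem kBlk_all : ∀ c : Fin 4, c ≠ 0 →
    allBelow 170 (fun i => allBelow 170 (fun j => kBlk c i j)) = true := by
  decide +kernel

def kwF (i : ℕ) : Fin 4 := ⟨kw i, Nat.mod_lt _ (by norm_num)⟩

/-- The infinite Keränen word. -/
def kV (n : ℕ) : Fin 4 := if _h : n = 0 then 0 else kwF (n % 85) + kV (n / 85)
termination_by n
decreasing_by omega

theorem kwF_zero : kwF 0 = 0 := by decide +kernel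

theorem kV_rec (n i : ℕ) (hi : i < 85) : kV (85 * n + i) = kwF i + kV n := by
  by_cases h : 85 * n + i = 0
  · have hn : n = 0 := by omega
    have hi0 : i = 0 := by omega
    subst hn hi0
    rw [kwF_zero]; simp
  · rw [kV, dif_neg h]
    congr 2 <;> omega

def kC (x : Fin 4) (n : ℕ) : ℕ := ∑ t ∈ Finset.range n, if kV t = x then 1 else 0

theorem kC_zero (x : Fin 4) : kC x 0 = 0 := by simp [kC]

theorem kC_succ (x : Fin 4) (n : ℕ) : kC x (n + 1) = kC x n + if kV n = x then 1 else 0 := by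
  unfold kC
  rw [Finset.sum_range_succ]

theorem kC_block (x : Fin 4) (n i : ℕ) (hi : i ≤ 85) :
    kC x (85 * n + i) = kC x (85 * n) + kP i (x - kV n) := by
  induction i with
  | zero => simp [kP_zero]
  | succ i ih =>
    rw [← add_assoc, kC_succ, ih (by omega), kP_succ i (by omega), kV_rec n i (by omega), add_assoc]
    congr 2
    have : (kwF i + kV n = x) ↔ (kw i = (x - kV n).val) := by
      rw [← eq_sub_iff_add_eq]
      constructor
      · intro h; rw [← h]; rfl
      · intro h; exact Fin.ext h
    simp only [this]

theorem kC_mul (x : Fin 4) (n : ℕ) :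
    kC x (85 * n) = ∑ y : Fin 4, kC y n * kP 85 (x - y) := by
  induction n with
  | zero => simp [kC_zero]
  | succ n ih =>
    rw [Nat.mul_succ, kC_block x n 85 le_rfl, ih]
    simp only [kC_succ, add_mul, Finset.sum_add_distrib]
    simp

theorem kC_total (n : ℕ) : kC 0 n + kC 1 n + kC 2 n + kC 3 n = n := by
  induction n with
  | zero => simp [kC_zero]
  | succ n ih =>
    simp only [kC_succ]
    have : ∀ v : Fin 4, (if v = 0 then 1 else 0) + (if v = 1 then 1 else 0)
      + (if v = 2 then 1 else 0) + (if v = 3 then 1 else 0) = 1 := by decide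
    have := this (kV n)
    omega

theorem kLin (E0 E1 E2 E3 : ℤ)
    (t0 : 19 * E0 + 18 * E1 + 27 * E2 + 21 * E3 = 0)
    (t1 : 21 * E0 + 19 * E1 + 18 * E2 + 27 * E3 = 0)
    (t2 : 27 * E0 + 21 * E1 + 19 * E2 + 18 * E3 = 0)
    (t3 : 18 * E0 + 27 * E1 + 21 * E2 + 19 * E3 = 0) :
    E0 = 0 ∧ E1 = 0 ∧ E2 = 0 ∧ E3 = 0 := by
  have h0 : 43435 * E0 = 0 := by
    linear_combination (-701) * t0 + (-531) * t1 + (4059) * t2 + (-2316) * t3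
  have h1 : 43435 * E1 = 0 := by
    linear_combination (-2316) * t0 + (-701) * t1 + (-531) * t2 + (4059) * t3
  have h2 : 43435 * E2 = 0 := by
    linear_combination (4059) * t0 + (-2316) * t1 + (-701) * t2 + (-531) * t3
  have h3 : 43435 * E3 = 0 := by
    linear_combination (-531) * t0 + (4059) * t1 + (-2316) * t2 + (-701) * t3
  have hn : (43435 : ℤ) ≠ 0 := by norm_num
  exact ⟨(mul_eq_zero.mp h0).resolve_left hn, (mul_eq_zero.mp h1).resolve_left hn,
    (mul_eq_zero.mp h2).resolve_left hn, (mul_eq_zero.mp h3).resolve_left hn⟩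

theorem kMod (e0 e1 e2 e3 : ℤ) (I0 I1 I2 I3 J0 J1 J2 J3 K0 K1 K2 K3 u v w : ℕ)
    (q0 : e0 * 19 + e1 * 18 + e2 * 27 + e3 * 21 = (I0 : ℤ) + K0 - 2 * J0)
    (q1 : e0 * 21 + e1 * 19 + e2 * 18 + e3 * 27 = (I1 : ℤ) + K1 - 2 * J1)
    (q2 : e0 * 27 + e1 * 21 + e2 * 19 + e3 * 18 = (I2 : ℤ) + K2 - 2 * J2)
    (q3 : e0 * 18 + e1 * 27 + e2 * 21 + e3 * 19 = (I3 : ℤ) + K3 - 2 * J3)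
    (s1 : (I0 + 30176 * I1 + 19636 * I2 + 39101 * I3) % 43435 = u % 43435)
    (s2 : (K0 + 30176 * K1 + 19636 * K2 + 39101 * K3) % 43435 = v % 43435)
    (s3 : (J0 + 30176 * J1 + 19636 * J2 + 39101 * J3) % 43435 = w % 43435) :
    (u + v) % 43435 = (2 * w) % 43435 := by
  have hs : 1 * ((I0 : ℤ) + K0 - 2 * J0) + 30176 * ((I1 : ℤ) + K1 - 2 * J1) + 19636 * ((I2 : ℤ) + K2 - 2 * J2) + 39101 * ((I3 : ℤ) + K3 - 2 * J3)
      = 43435 * (43 * e0 + 47 * e1 + 40 * e2 + 44 * e3) := by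
    linear_combination (-1) * q0 + (-30176) * q1 + (-19636) * q2 + (-39101) * q3
  generalize 43 * e0 + 47 * e1 + 40 * e2 + 44 * e3 = F at hs
  clear q0 q1 q2 q3
  omega

/-- Key algebraic step: an arithmetic progression of prefix vectors comes from one in the
preimage. -/
theorem kKey (a b c : Fin 4) (i j k : ℕ) (hi : i < 85) (hj : j < 85) (hk : k < 85)
    (hm : k = (2 * j + 85 - i) % 85) (e : Fin 4 → ℤ)
    (h : ∀ x : Fin 4, ∑ y : Fin 4, e y * (kP 85 (x - y) : ℤ)
      = kP i (x - a) + kP k (x - c) - 2 * kP j (x - b)) :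
    ∃ d1 d2 d3 : Fin 2, ∀ x : Fin 4, e x = d1.val * (if a = x then 1 else 0)
      + d3.val * (if c = x then 1 else 0) - 2 * d2.val * (if b = x then 1 else 0) := by
  have hchk := allBelow_spec (allBelow_spec (kChk_all (a - b) (c - b)) i hi) j hj
  rw [← hm] at hchk
  -- rotated equation
  have h' : ∀ x : Fin 4, ∑ y : Fin 4, e (y + b) * (kP 85 (x - y) : ℤ)
      = kP i (x - (a - b)) + kP k (x - (c - b)) - 2 * kP j x := by
    intro x
    have h1 := h (x + b)
    rw [← Equiv.sum_comp (Equiv.addRight b)] at h1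
    simp only [Equiv.coe_addRight, add_sub_add_right_eq_sub, add_sub_cancel_right] at h1
    rw [h1]
    congr 4 <;> abel_nf
  obtain ⟨m0, m1, m2, m3⟩ := kP_85
  have e00 : (0 - 1 : Fin 4) = 3 := by decide
  have e01 : (0 - 2 : Fin 4) = 2 := by decide
  have e02 : (0 - 3 : Fin 4) = 1 := by decide
  have e11 : (1 - 2 : Fin 4) = 3 := by decide
  have e12 : (1 - 3 : Fin 4) = 2 := by decide
  have e21 : (2 - 1 : Fin 4) = 1 := by decide
  have e22 : (2 - 3 : Fin 4) = 3 := by decide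
  have e31 : (3 - 1 : Fin 4) = 2 := by decide
  have e32 : (3 - 2 : Fin 4) = 1 := by decide
  have q0 := h' 0
  have q1 := h' 1
  have q2 := h' 2
  have q3 := h' 3
  simp only [Fin.sum_univ_four, sub_self, sub_zero, e00, e01, e02, e11, e12, e21, e22, e31, e32,
    m0, m1, m2, m3] at q0 q1 q2 q3
  push_cast at q0 q1 q2 q3
  by_cases hb : Nat.beq ((kLam (a - b) * kRes i + kLam (c - b) * kRes k) % 43435)
      ((2 * kRes j) % 43435) = true
  · rw [kChk, hb, cond_true, decide_eq_true_eq] at hchk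
    obtain ⟨d1, d2, d3, hd⟩ := hchk
    refine ⟨d1, d2, d3, ?_⟩
    -- it suffices to prove the rotated form
    suffices hs : ∀ x : Fin 4, e (x + b) = d1.val * (if a - b = x then 1 else 0)
      + d3.val * (if c - b = x then 1 else 0) - 2 * d2.val * (if 0 = x then 1 else 0) by
      intro x
      have := hs (x - b)
      rw [sub_add_cancel] at this
      rw [this]
      simp only [sub_left_inj, eq_comm (a := (0 : Fin 4)), sub_eq_zero, eq_comm (a := b)]
    generalize a - b = a' at *
    generalize c - b = c' at *
    clear h h' hm hb
    have hM : ∀ a' : Fin 4, ∀ x : Fin 4, kP 85 (x - a') =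
        ∑ y : Fin 4, (if a' = y then 1 else 0) * kP 85 (x - y) := by
      intro a' x; simp
    have r0 := hd 0
    have r1 := hd 1
    have r2 := hd 2
    have r3 := hd 3
    rw [hM a', hM c'] at r0 r1 r2 r3
    simp only [Fin.sum_univ_four, sub_self, sub_zero, e00, e01, e02, e11, e12, e21, e22, e31, e32,
      m0, m1, m2, m3] at r0 r1 r2 r3
    zify at r0 r1 r2 r3
    obtain ⟨E, hE⟩ : ∃ E : Fin 4 → ℤ, ∀ x, E x = e (x + b) - (d1.val * (if a' = x then 1 else 0)
      + d3.val * (if c' = x then 1 else 0) - 2 * d2.val * (if 0 = x then 1 else 0)) :=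
      ⟨_, fun _ => rfl⟩
    have z0 : ((if (0 : Fin 4) = 0 then 1 else 0 : ℤ)) = 1 := by decide
    have z1 : ((if (0 : Fin 4) = 1 then 1 else 0 : ℤ)) = 0 := by decide
    have z2 : ((if (0 : Fin 4) = 2 then 1 else 0 : ℤ)) = 0 := by decide
    have z3 : ((if (0 : Fin 4) = 3 then 1 else 0 : ℤ)) = 0 := by decide
    have t0 : 19 * E 0 + 18 * E 1 + 27 * E 2 + 21 * E 3 = 0 := by
      rw [hE, hE, hE, hE, z0, z1, z2, z3]
      linear_combination q0 + r0
    have t1 : 21 * E 0 + 19 * E 1 + 18 * E 2 + 27 * E 3 = 0 := by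
      rw [hE, hE, hE, hE, z0, z1, z2, z3]
      linear_combination q1 + r1
    have t2 : 27 * E 0 + 21 * E 1 + 19 * E 2 + 18 * E 3 = 0 := by
      rw [hE, hE, hE, hE, z0, z1, z2, z3]
      linear_combination q2 + r2
    have t3 : 18 * E 0 + 27 * E 1 + 21 * E 2 + 19 * E 3 = 0 := by
      rw [hE, hE, hE, hE, z0, z1, z2, z3]
      linear_combination q3 + r3
    obtain ⟨y0, y1, y2, y3⟩ := kLin _ _ _ _ t0 t1 t2 t3
    have hz : ∀ x, E x = 0 := by
      intro x
      fin_cases x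
      · exact y0
      · exact y1
      · exact y2
      · exact y3
    intro x
    have h3 := hE x
    rw [hz x] at h3
    linarith
  · exfalso
    apply hb
    have s1 := kRes_spec i hi (a - b)
    have s2 := kRes_spec k hk (c - b)
    have s3 := kRes_spec j hj 0
    rw [Nat.beq_eq]
    have l0 : kLam 0 = 1 := rfl
    have l1 : kLam 1 = 30176 := rfl
    have l2 : kLam 2 = 19636 := rfl
    have l3 : kLam 3 = 39101 := rfl
    generalize kLam (a - b) * kRes i = u at *
    generalize kLam (c - b) * kRes k = v at *
    simp only [sub_zero, l0, l1, l2, l3, one_mul] at s1 s2 s3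
    exact kMod _ _ _ _ _ _ _ _ _ _ _ _ _ _ _ _ _ _ _ q0 q1 q2 q3 s1 s2 s3

theorem kMain : ∀ r p q : ℕ, p < q → (∀ x, kC x p + kC x r = 2 * kC x q) → False := by
  intro r
  induction r using Nat.strong_induction_on with
  | _ r ih =>
  intro p q hpq h
  have hlen : ∀ p q r, (∀ x, kC x p + kC x r = 2 * kC x q) → p + r = 2 * q := by
    intro p q r h
    have := kC_total p
    have := kC_total q
    have := kC_total r
    have := h 0
    have := h 1
    have := h 2
    have := h 3
    omega
  have hl := hlen p q r h
  obtain ⟨α, i, hi, rfl⟩ : ∃ α i, i < 85 ∧ p = 85 * α + i :=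
    ⟨p / 85, p % 85, by omega, by omega⟩
  obtain ⟨β, j, hj, rfl⟩ : ∃ α i, i < 85 ∧ q = 85 * α + i :=
    ⟨q / 85, q % 85, by omega, by omega⟩
  obtain ⟨γ, k, hk, rfl⟩ : ∃ α i, i < 85 ∧ r = 85 * α + i :=
    ⟨r / 85, r % 85, by omega, by omega⟩
  have hkey := kKey (kV α) (kV β) (kV γ) i j k hi hj hk (by omega)
    (fun x => 2 * kC x β - kC x α - kC x γ) (by
      intro x
      have h1 := h x
      rw [kC_block _ _ _ hi.le, kC_block _ _ _ hj.le, kC_block _ _ _ hk.le, kC_mul, kC_mul,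
        kC_mul] at h1
      zify at h1
      simp only [sub_mul, Finset.sum_sub_distrib, mul_assoc, ← Finset.mul_sum]
      linarith)
  obtain ⟨d1, d2, d3, hd⟩ := hkey
  have hup : ∀ (d : Fin 2) (x : Fin 4) (n : ℕ),
      kC x (n + d.val) = kC x n + d.val * if kV n = x then 1 else 0 := by
    intro d x n
    fin_cases d
    · simp
    · simp [kC_succ]
  have h2 : ∀ x, kC x (α + d1.val) + kC x (γ + d3.val) = 2 * kC x (β + d2.val) := by
    intro x
    have h1 := hd x
    rw [hup, hup, hup]
    zify
    linarith
  have hl2 := hlen _ _ _ h2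
  have b1 := d1.isLt
  have b2 := d2.isLt
  have b3 := d3.isLt
  have hlt : γ + d3.val < 85 * γ + k := by omega
  have heq : ¬ α + d1.val < β + d2.val := fun hc => ih _ hlt _ _ hc h2
  have hγ : γ ≤ α + 1 := by omega
  -- all inside the image of two adjacent letters
  have hadj : kV α ≠ kV (α + 1) ∨ γ = α := by
    by_cases hg : γ = α
    · exact Or.inr hg
    · left
      intro hc
      refine ih (α + 2) (by omega) α (α + 1) (by omega) ?_
      intro x
      have := kC_succ x α
      have h3 : kC x (α + 2) = _ := kC_succ x (α + 1)
      rw [← hc] at h3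
      omega
  obtain ⟨c, hc0, hc⟩ : ∃ c : Fin 4, c ≠ 0 ∧ (γ = α ∨ kV (α + 1) = kV α + c) := by
    rcases hadj with h1 | h1
    · exact ⟨kV (α + 1) - kV α, sub_ne_zero.mpr (Ne.symm h1), Or.inr (by abel)⟩
    · exact ⟨1, by decide, Or.inl h1⟩
  have hQ : ∀ δ l, l < 85 → α ≤ δ → δ ≤ γ → ∀ x, kC (x + kV α) (85 * δ + l) =
      kC (x + kV α) (85 * α) + kQ c (85 * (δ - α) + l) x := by
    intro δ l hl h1 h2 x
    rcases Nat.eq_or_lt_of_le h1 with h3 | h3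
    · subst h3
      rw [kC_block _ _ _ hl.le, kQ]
      have : Nat.blt (85 * (α - α) + l) 85 = true := by rw [Nat.blt_eq]; omega
      rw [this, cond_true]
      simp
    · have h4 : δ = α + 1 := by omega
      subst h4
      have h5 : kV (α + 1) = kV α + c := by
        rcases hc with h6 | h6
        · omega
        · exact h6
      rw [kC_block _ _ _ hl.le, kQ]
      have : Nat.blt (85 * (α + 1 - α) + l) 85 = false := by
        rw [Bool.eq_false_iff, Ne, Nat.blt_eq]; omega
      rw [this, cond_false, Nat.mul_succ, kC_block _ _ 85 le_rfl, h5]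
      have e1 : x + kV α - (kV α + c) = x - c := by abel
      have e2 : 85 * (α + 1 - α) + l - 85 = l := by omega
      rw [e1, e2, add_sub_cancel_right, add_assoc]
  have hblk := allBelow_spec (allBelow_spec (kBlk_all c hc0) i (by omega))
    (85 * (β - α) + j) (by omega)
  have hcond : (Nat.blt i (85 * (β - α) + j) && Nat.blt (2 * (85 * (β - α) + j)) (170 + i)) = true := by
    rw [Bool.and_eq_true, Nat.blt_eq, Nat.blt_eq]
    omega
  have hfin : ∀ x, Nat.beq (kQ c i x + kQ c (2 * (85 * (β - α) + j) - i) x)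
      (2 * kQ c (85 * (β - α) + j) x) = true := by
    intro x
    rw [Nat.beq_eq]
    have h1 := h (x + kV α)
    rw [hQ α i hi (by omega) (by omega), hQ β j hj (by omega) (by omega),
      hQ γ k hk (by omega) (by omega)] at h1
    have e1 : 85 * (α - α) + i = i := by omega
    have e2 : 85 * (γ - α) + k = 2 * (85 * (β - α) + j) - i := by omega
    rw [e1, e2] at h1
    omega
  rw [kBlk, hcond, cond_true, hfin, hfin, hfin, hfin] at hblk
  simp at hblk

theorem kC_eq_count (x : Fin 4) (n : ℕ) : kC x n = ((List.range n).map kV).count x := by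
  induction n with
  | zero => simp [kC_zero]
  | succ n ih =>
    rw [kC_succ, List.range_succ, List.map_append, List.count_append, ← ih]
    congr 1
    simp [List.count_singleton]

theorem kV_anagramFree (n : ℕ) (l : List (Fin 4)) (hl : l <:+: (List.range n).map kV) :
    ¬ IsAnagram l := by
  rintro ⟨w₁, w₂, hne, hperm, rfl⟩
  obtain ⟨s, t, hst⟩ := hl
  have hpre : ∀ a : List (Fin 4), a <+: (List.range n).map kV → ∀ x, kC x a.length = a.count x := by
    intro a ha x
    have h1 := List.prefix_iff_eq_take.mp ha
    have h2 : a.length ≤ n := by simpa using ha.length_le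
    rw [kC_eq_count]
    conv_rhs => rw [h1]
    rw [← List.map_take, List.take_range, Nat.min_eq_left h2]
  have hlen : w₁.length ≠ 0 := fun h => hne (List.length_eq_zero_iff.mp h)
  refine kMain (s ++ (w₁ ++ w₂)).length s.length (s ++ w₁).length ?_ ?_
  · simp; omega
  · intro x
    rw [hpre _ ⟨t, hst⟩, hpre s ⟨w₁ ++ w₂ ++ t, by rw [← hst]; simp⟩,
      hpre (s ++ w₁) ⟨w₂ ++ t, by rw [← hst]; simp⟩]
    have := hperm.count_eq x
    simp only [List.count_append]
    omega

theorem IsAnagram.of_map {α β : Type*} {g : α → β} (hg : Function.Injective g) {l : List α}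
    (h : IsAnagram (l.map g)) : IsAnagram l := by
  obtain ⟨w₁, w₂, hne, hp, he⟩ := h
  obtain ⟨l₁, l₂, rfl, rfl, rfl⟩ := List.map_eq_append_iff.mp he
  refine ⟨l₁, l₂, ?_, (List.map_perm_map_iff hg).mp hp, rfl⟩
  rintro rfl
  exact hne rfl

theorem IsAnagram.reverse {α : Type*} {l : List α} (h : IsAnagram l) : IsAnagram l.reverse := by
  obtain ⟨w₁, w₂, hne, hp, rfl⟩ := h
  refine ⟨w₂.reverse, w₁.reverse, ?_, ?_, by simp⟩
  · intro h
    rw [List.reverse_eq_nil_iff] at h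
    subst h
    exact hne hp.eq_nil
  · exact (List.reverse_perm _).trans (hp.symm.trans (List.reverse_perm _).symm)

theorem strip_walk {V : Type} {G : SimpleGraph V} (S : V → Bool) {u v : V} (Q : G.Walk u v)
    (hQ : Q.IsPath) (h : ∃ z ∈ Q.support, S z = true) :
    ∃ (a : V) (R : G.Walk a v), R.IsPath ∧ S a = true ∧
      R.support.filter S = Q.support.filter S := by
  induction Q with
  | nil =>
    obtain ⟨z, hz, hS⟩ := h
    simp only [SimpleGraph.Walk.support_nil, List.mem_singleton] at hz
    subst hz
    exact ⟨_, .nil, hQ, hS, rfl⟩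
  | @cons u u' v hadj Q ih =>
    by_cases hu : S u = true
    · exact ⟨u, .cons hadj Q, hQ, hu, rfl⟩
    · have h' : ∃ z ∈ Q.support, S z = true := by
        obtain ⟨z, hz, hS⟩ := h
        rw [SimpleGraph.Walk.support_cons, List.mem_cons] at hz
        rcases hz with rfl | hz
        · exact absurd hS hu
        · exact ⟨z, hz, hS⟩
      obtain ⟨a, R, h1, h2, h3⟩ := ih hQ.of_cons h'
      refine ⟨a, R, h1, h2, ?_⟩
      rw [h3, SimpleGraph.Walk.support_cons, List.filter_cons_of_neg hu]

theorem subpath_infix {V : Type} [DecidableEq V] {G : SimpleGraph V} (hG : G.IsAcyclic) {x y a b : V}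
    (P : G.Walk x y) (hP : P.IsPath) (R : G.Walk a b) (hR : R.IsPath)
    (ha : a ∈ P.support) (hb : b ∈ P.support) :
    R.support <:+: P.support ∨ R.support <:+: P.support.reverse := by
  have hb' := hb
  rw [← P.take_spec ha, SimpleGraph.Walk.mem_support_append_iff] at hb'
  rcases hb' with h | h
  · right
    have hp : ((P.takeUntil a ha).dropUntil b h).reverse.IsPath :=
      ((hP.takeUntil ha).dropUntil h).reverse
    have he := congrArg Subtype.val (hG.path_unique ⟨R, hR⟩ ⟨_, hp⟩)
    simp only at he
    rw [he, SimpleGraph.Walk.support_reverse, List.reverse_infix]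
    exact ((P.takeUntil a ha).support_dropUntil_suffix_support h).isInfix.trans
      (P.support_takeUntil_prefix_support ha).isInfix
  · left
    have hp : ((P.dropUntil a ha).takeUntil b h).IsPath := (hP.dropUntil ha).takeUntil h
    have he := congrArg Subtype.val (hG.path_unique ⟨R, hR⟩ ⟨_, hp⟩)
    simp only at he
    rw [he]
    exact ((P.dropUntil a ha).support_takeUntil_prefix_support h).isInfix.trans
      (P.support_dropUntil_suffix_support ha).isInfix

theorem filter_infix {V : Type} [DecidableEq V] {G : SimpleGraph V} (hG : G.IsAcyclic) {x y u v : V}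
    (P : G.Walk x y) (hP : P.IsPath) (Q : G.Walk u v) (hQ : Q.IsPath) :
    Q.support.filter (fun z => decide (z ∈ P.support)) <:+: P.support ∨
    Q.support.filter (fun z => decide (z ∈ P.support)) <:+: P.support.reverse := by
  set S : V → Bool := fun z => decide (z ∈ P.support) with hS
  by_cases h : ∃ z ∈ Q.support, S z = true
  · obtain ⟨a, R, hR, ha, he⟩ := strip_walk S Q hQ h
    have h2 : ∃ z ∈ R.reverse.support, S z = true := ⟨a, by simp, ha⟩
    obtain ⟨b, R', hR', hb, he'⟩ := strip_walk S R.reverse hR.reverse h2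
    have hin := subpath_infix hG P hP R'.reverse hR'.reverse (by simpa [hS] using ha)
      (by simpa [hS] using hb)
    have hall : ∀ z ∈ R'.reverse.support, S z = true := by
      intro z hz
      simp only [hS, decide_eq_true_eq]
      rcases hin with hi | hi
      · exact hi.subset hz
      · exact List.mem_reverse.mp (hi.subset hz)
    have e : Q.support.filter S = R'.reverse.support := by
      rw [← List.filter_eq_self.mpr hall, SimpleGraph.Walk.support_reverse, List.filter_reverse, he',
        SimpleGraph.Walk.support_reverse, List.filter_reverse, List.reverse_reverse, he]
    rw [e]
    exact hin
  · left
    have : Q.support.filter S = [] := by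
      rw [List.filter_eq_nil_iff]
      intro z hz hz'
      exact h ⟨z, hz, hz'⟩
    rw [this]
    exact List.nil_infix

theorem walk_meets_bag {V : Type} {G : SimpleGraph V} {n : ℕ} (B : Fin n → Finset V)
    (hE : ∀ ⦃u v : V⦄, G.Adj u v → ∃ i, u ∈ B i ∧ v ∈ B i)
    (hI : ∀ (v : V) (i j k : Fin n), i ≤ j → j ≤ k → v ∈ B i → v ∈ B k → v ∈ B j)
    {x y : V} (P : G.Walk x y) (i j k : Fin n) (hij : i ≤ j) (hjk : j ≤ k)
    (hx : x ∈ B i) (hy : y ∈ B k) : ∃ v ∈ P.support, v ∈ B j := by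
  induction P generalizing i with
  | nil => exact ⟨_, by simp, hI _ i j k hij hjk hx hy⟩
  | cons hadj P ih =>
    obtain ⟨l, h1, h2⟩ := hE hadj
    rcases le_total j l with hl | hl
    · exact ⟨_, by simp, hI _ i j l hij hl hx h1⟩
    · obtain ⟨v, hv, hv'⟩ := ih l hl h2 hy
      exact ⟨v, by simp [hv], hv'⟩

theorem component_path {V : Type} {G : SimpleGraph V} {n : ℕ} (B : Fin n → Finset V)
    (hV : ∀ v : V, ∃ i, v ∈ B i)
    (hE : ∀ ⦃u v : V⦄, G.Adj u v → ∃ i, u ∈ B i ∧ v ∈ B i)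
    (hI : ∀ (v : V) (i j k : Fin n), i ≤ j → j ≤ k → v ∈ B i → v ∈ B k → v ∈ B j)
    (c : G.ConnectedComponent) :
    ∃ (x y : V) (P : G.Walk x y), P.IsPath ∧ G.connectedComponentMk x = c ∧
      ∀ u, G.connectedComponentMk u = c → ∀ j, u ∈ B j → ∃ v ∈ P.support, v ∈ B j := by
  classical
  set I : Finset (Fin n) :=
    Finset.univ.filter (fun i => ∃ v ∈ B i, G.connectedComponentMk v = c) with hIdef
  have hne : I.Nonempty := by
    obtain ⟨v, hv⟩ := c.exists_rep
    obtain ⟨i, hi⟩ := hV v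
    exact ⟨i, by simp only [hIdef, Finset.mem_filter, Finset.mem_univ, true_and]; exact ⟨v, hi, hv⟩⟩
  have hmin := I.min'_mem hne
  have hmax := I.max'_mem hne
  obtain ⟨x, hx, hxc⟩ := (Finset.mem_filter.mp hmin).2
  obtain ⟨y, hy, hyc⟩ := (Finset.mem_filter.mp hmax).2
  obtain ⟨P, hP⟩ := (SimpleGraph.ConnectedComponent.exact (hxc.trans hyc.symm)).exists_isPath
  refine ⟨x, y, P, hP, hxc, ?_⟩
  intro u hu j hj
  have hjI : j ∈ I := Finset.mem_filter.mpr ⟨Finset.mem_univ _, u, hj, hu⟩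
  exact walk_meets_bag B hE hI P _ j _ (I.min'_le j hjI) (I.le_max' j hjI) hx hy

theorem not_isAnagram_singleton {α : Type*} (a : α) : ¬ IsAnagram [a] := by
  rintro ⟨w₁, w₂, hne, hp, he⟩
  have h1 := hp.length_eq
  have h2 := congrArg List.length he
  simp at h2
  omega

theorem map_idxOf_eq {V : Type} [DecidableEq V] (l : List V) (hl : l.Nodup) :
    l.map (fun z => kV (l.idxOf z)) = (List.range l.length).map kV := by
  apply List.ext_getElem
  · simp
  · intro i h1 h2
    simp [hl.idxOf_getElem]

theorem forest_colouring (m : ℕ) : ∀ {V : Type} (G : SimpleGraph V), G.IsAcyclic →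
    HasPathDecomp G m → ∃ f : V → Fin (4 * m + 1), AnagramFreeVC G f := by
  induction m with
  | zero =>
    intro V G hG ⟨n, B, hV, hE, hI, hB⟩
    refine ⟨fun _ => 0, ?_⟩
    intro u v p hp
    cases p with
    | nil => exact not_isAnagram_singleton _
    | cons hadj p =>
      obtain ⟨i, h1, h2⟩ := hE hadj
      exact absurd (Finset.card_le_one.mp (hB i) _ h1 _ h2) hadj.ne
  | succ m ih =>
    intro V G hG ⟨n, B, hV, hE, hI, hB⟩
    classical
    choose x y P hP hc hmeet using component_path B hV hE hI
    let S : Set V := {v | v ∈ (P (G.connectedComponentMk v)).support}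
    have hcomp : ∀ {u v : V} (Q : G.Walk u v), ∀ z ∈ Q.support,
        G.connectedComponentMk z = G.connectedComponentMk u := by
      intro u v Q z hz
      exact (SimpleGraph.ConnectedComponent.sound ⟨Q.takeUntil z hz⟩).symm
    have hPS : ∀ c, ∀ z ∈ (P c).support, z ∈ S := by
      intro c z hz
      have h1 := (hcomp (P c) z hz).trans (hc c)
      change z ∈ (P (G.connectedComponentMk z)).support
      rw [h1]; exact hz
    -- the rest has smaller width
    have hrest : HasPathDecomp (G.induce Sᶜ) m := by
      refine ⟨n, fun i => (B i).subtype (· ∈ Sᶜ), ?_, ?_, ?_, ?_⟩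
      · rintro ⟨v, hv⟩
        obtain ⟨i, hi⟩ := hV v
        exact ⟨i, by simpa using hi⟩
      · rintro ⟨u, hu⟩ ⟨v, hv⟩ hadj
        obtain ⟨i, h1, h2⟩ := hE (SimpleGraph.induce_adj.mp hadj)
        exact ⟨i, by simpa using h1, by simpa using h2⟩
      · rintro ⟨v, hv⟩ i j k hij hjk h1 h2
        rw [Finset.mem_subtype] at h1 h2 ⊢
        exact hI v i j k hij hjk h1 h2
      · intro i
        rw [Finset.card_subtype]
        by_cases hne : (B i).Nonempty
        · obtain ⟨u, hu⟩ := hne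
          obtain ⟨v, hv, hv'⟩ := hmeet _ u rfl i hu
          have hlt : ((B i).filter (· ∈ Sᶜ)).card < (B i).card := by
            apply Finset.card_lt_card
            rw [Finset.filter_ssubset]
            exact ⟨v, hv', fun h => h (hPS _ v hv)⟩
          have := hB i
          omega
        · rw [Finset.not_nonempty_iff_eq_empty] at hne
          simp [hne]
    obtain ⟨f', hf'⟩ := ih (G.induce Sᶜ) (hG.induce _) hrest
    let emb : Fin 4 → Fin (4 * (m + 1) + 1) := fun c => ⟨4 * m + 1 + c.val, by omega⟩
    have hemb : Function.Injective emb := by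
      intro a b hab
      have := congrArg Fin.val hab
      simp only [emb] at this
      exact Fin.ext (by omega)
    let low : Fin (4 * m + 1) → Fin (4 * (m + 1) + 1) := Fin.castLE (by omega)
    let f : V → Fin (4 * (m + 1) + 1) := fun v =>
      if h : v ∈ S then emb (kV ((P (G.connectedComponentMk v)).support.idxOf v))
      else low (f' ⟨v, h⟩)
    have hfS : ∀ v, v ∈ S → f v = emb (kV ((P (G.connectedComponentMk v)).support.idxOf v)) :=
      fun v h => dif_pos h
    have hfN : ∀ v (h : v ∉ S), f v = low (f' ⟨v, h⟩) := fun v h => dif_neg h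
    refine ⟨f, ?_⟩
    intro u v Q hQ hA
    obtain ⟨w₁, w₂, hne, hp, he⟩ := hA
    let pr : Fin (4 * (m + 1) + 1) → Bool := fun c => decide (4 * m + 1 ≤ c.val)
    have hpr : ∀ z, pr (f z) = true ↔ z ∈ S := by
      intro z
      by_cases hz : z ∈ S
      · rw [hfS z hz]; simp only [pr, emb, hz, decide_eq_true_eq, iff_true]; omega
      · rw [hfN z hz]
        have := (f' ⟨z, hz⟩).isLt
        simp only [pr, low, Fin.val_castLE, decide_eq_true_eq, hz, iff_false]
        omega
    by_cases hemp : w₁.filter pr = []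
    · have hemp2 : w₂.filter pr = [] := (hemp ▸ hp.filter pr).nil_eq.symm
      have hQS : ∀ z ∈ Q.support, z ∈ Sᶜ := by
        intro z hz hzS
        have h1 : f z ∈ w₁ ++ w₂ := he ▸ List.mem_map_of_mem hz
        have h2 : (w₁ ++ w₂).filter pr = [] := by rw [List.filter_append, hemp, hemp2]; rfl
        exact List.filter_eq_nil_iff.mp h2 _ h1 ((hpr z).mpr hzS)
      have hmap : (Q.induce Sᶜ hQS).support.map (Subtype.val : ↥Sᶜ → V) = Q.support := by
        simp
      have hpath : (Q.induce Sᶜ hQS).IsPath := by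
        rw [SimpleGraph.Walk.isPath_def]
        apply List.Nodup.of_map (Subtype.val : ↥Sᶜ → V)
        rw [hmap]
        exact hQ.support_nodup
      refine hf' _ hpath (IsAnagram.of_map (g := low) (Fin.castLE_injective _) ?_)
      refine ⟨w₁, w₂, hne, hp, ?_⟩
      rw [← he, ← hmap, List.map_map, List.map_map]
      apply List.map_congr_left
      rintro ⟨z, hz⟩ -
      exact (hfN z hz).symm
    · set c := G.connectedComponentMk u with hcu
      let h : V → Fin 4 := fun z => kV ((P c).support.idxOf z)
      set L := Q.support.filter (fun z => decide (z ∈ (P c).support)) with hL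
      have hLf : L.map f = w₁.filter pr ++ w₂.filter pr := by
        rw [← List.filter_append, ← he, List.filter_map]
        congr 1
        apply List.filter_congr
        intro z hz
        have hzc := hcomp Q z hz
        have h1 : z ∈ S ↔ z ∈ (P c).support := by
          change z ∈ (P (G.connectedComponentMk z)).support ↔ _
          rw [hzc]
        rw [Bool.eq_iff_iff, decide_eq_true_eq, ← h1]
        exact (hpr z).symm
      have hLh : L.map f = (L.map h).map emb := by
        rw [List.map_map]
        apply List.map_congr_left
        intro z hz
        have hz2 := List.mem_filter.mp hz
        have hzP : z ∈ (P c).support := by simpa using hz2.2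
        rw [hfS z (hPS c z hzP), hcomp Q z hz2.1]
        rfl
      have hAn : IsAnagram (L.map h) := by
        apply IsAnagram.of_map hemb
        rw [← hLh]
        exact ⟨_, _, hemp, hp.filter pr, hLf⟩
      have hword := map_idxOf_eq (P c).support (hP c).support_nodup
      rcases filter_infix hG (P c) (hP c) Q hQ with hi | hi
      · refine kV_anagramFree (P c).support.length _ ?_ hAn
        rw [← hword]
        exact hi.map h
      · refine kV_anagramFree (P c).support.length _ ?_ hAn.reverse
        rw [← hword, ← List.map_reverse, ← List.reverse_infix, ← List.map_reverse, List.reverse_reverse,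
          ← List.map_reverse]
        exact hi.map h

/-- Every tree of pathwidth (at most) `m` has an anagram-free
vertex colouring using at most `4 * m + 1` colours, i.e. `φ(T) ≤ 4·pw(T) + 1`. -/
theorem anagramFree_chromatic_le_four_pathwidth_add_one {V : Type} [Finite V]
    (G : SimpleGraph V) (hG : G.IsTree) (m : ℕ) (hpw : HasPathDecomp G m) :
    ∃ f : V → Fin (4 * m + 1), AnagramFreeVC G f := by
  exact forest_colouring m G hG.isAcyclic hpw
end

section
/- For every integer p ≥ 0 there exists a tree T with φ(T) ≥ p ≥ pw(T), i.e. a tree of pathwidth at most p whose every anagram-free vertex colouring uses at least p colours. -/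
/-- A root joined to `B` disjoint copies of the rooted graph `(G, r)`. -/
def joinCopies {V : Type} (B : ℕ) (G : SimpleGraph V) (r : V) :
    SimpleGraph (Option (Fin B × V)) where
  Adj x y := match x, y with
    | none, none => False
    | none, some (_, v) => v = r
    | some (_, v), none => v = r
    | some (b, v), some (b', v') => b = b' ∧ G.Adj v v'
  symm := ⟨by
    rintro (_ | ⟨b, v⟩) (_ | ⟨b', v'⟩) h
    · exact h
    · exact h
    · exact h
    · exact ⟨h.1.symm, h.2.symm⟩⟩
  loopless := ⟨by
    rintro (_ | ⟨b, v⟩) h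
    · exact h
    · exact G.loopless.irrefl _ h.2⟩

/-- The embedding of the `b`-th copy. -/
def copyHom {V : Type} {B : ℕ} (G : SimpleGraph V) (r : V) (b : Fin B) :
    G →g joinCopies B G r where
  toFun v := some (b, v)
  map_rel' h := ⟨rfl, h⟩

theorem copyHom_injective {V : Type} {B : ℕ} (G : SimpleGraph V) (r : V) (b : Fin B) :
    Function.Injective (copyHom G r b) := by
  intro x y h
  have h' : some (b, x) = some (b, y) := h
  simpa using h'

theorem acyclic_of_rank {V : Type} (G : SimpleGraph V) (d : V → ℕ)
    (h : ∀ v u w, G.Adj v u → G.Adj v w → d u ≤ d v → d w ≤ d v → u = w) :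
    G.IsAcyclic := by
  classical
  intro v c hc
  obtain ⟨m, hm, hmax⟩ := c.support.toFinset.exists_max_image d ⟨v, by simp⟩
  have hm' : m ∈ c.support := by simpa using hm
  have hc' := hc.rotate hm'
  have hmem : ∀ x ∈ (c.rotate m hm').support, d x ≤ d m := by
    intro x hx
    apply hmax
    simpa using hx
  exact hc'.snd_ne_penultimate (h m _ _ (SimpleGraph.Walk.adj_snd hc'.not_nil)
    (SimpleGraph.Walk.adj_penultimate hc'.not_nil).symm
    (hmem _ (SimpleGraph.Walk.getVert_mem_support _ _))
    (hmem _ (SimpleGraph.Walk.getVert_mem_support _ _)))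

theorem joinCopies_pathDecomp {V : Type} {B : ℕ} (hB : 0 < B) (G : SimpleGraph V) (r : V) (w : ℕ)
    (h : HasPathDecomp G w) : HasPathDecomp (joinCopies B G r) (w + 1) := by
  classical
  obtain ⟨n, A, h1, h2, h3, h4⟩ := h
  let A' : Fin (B * n) → Finset (Option (Fin B × V)) := fun i =>
    insert none ((A i.modNat).image (fun v => some (i.divNat, v)))
  have key : ∀ (b : Fin B) (i : Fin n), ∃ j : Fin (B * n), j.divNat = b ∧ j.modNat = i := by
    intro b i
    refine ⟨finProdFinEquiv (b, i), ?_⟩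
    have := finProdFinEquiv.symm_apply_apply (b, i)
    simpa [finProdFinEquiv, Prod.ext_iff] using this
  have hs : ∀ b v j, some (b, v) ∈ A' j ↔ j.divNat = b ∧ v ∈ A j.modNat := by
    intro b v j
    simp [A']
    tauto
  have hn : ∀ j, none ∈ A' j := fun j => by simp [A']
  have hr : ∀ b v, ∃ j, some (b, v) ∈ A' j := by
    intro b v
    obtain ⟨i, hi⟩ := h1 v
    obtain ⟨j, hj, hj'⟩ := key b i
    exact ⟨j, (hs _ _ _).2 ⟨hj, hj' ▸ hi⟩⟩
  refine ⟨B * n, A', ?_, ?_, ?_, ?_⟩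
  · rintro (_ | ⟨b, v⟩)
    · obtain ⟨j, _⟩ := hr ⟨0, hB⟩ r
      exact ⟨j, hn j⟩
    · exact hr b v
  · rintro (_ | ⟨b, v⟩) (_ | ⟨b', v'⟩) hadj
    · exact hadj.elim
    · obtain ⟨j, hj⟩ := hr b' v'
      exact ⟨j, hn j, hj⟩
    · obtain ⟨j, hj⟩ := hr b v
      exact ⟨j, hj, hn j⟩
    · obtain ⟨rfl, hadj⟩ := hadj
      obtain ⟨i, hi, hi'⟩ := h2 hadj
      obtain ⟨j, hj, rfl⟩ := key b i
      exact ⟨j, (hs _ _ _).2 ⟨hj, hi⟩, (hs _ _ _).2 ⟨hj, hi'⟩⟩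
  · rintro (_ | ⟨b, v⟩) i j k hij hjk hi hk
    · exact hn j
    · rw [hs] at hi hk ⊢
      obtain ⟨hi, hi'⟩ := hi
      obtain ⟨hk, hk'⟩ := hk
      have e1 : (i : ℕ) / n = b := by rw [← hi]; rfl
      have e2 : (k : ℕ) / n = b := by rw [← hk]; rfl
      have e3 : (j : ℕ) / n = b :=
        le_antisymm (e2 ▸ Nat.div_le_div_right hjk) (e1 ▸ Nat.div_le_div_right hij)
      have f1 := Nat.div_add_mod (i : ℕ) n
      have f2 := Nat.div_add_mod (j : ℕ) n
      have f3 := Nat.div_add_mod (k : ℕ) n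
      rw [e1] at f1
      rw [e3] at f2
      rw [e2] at f3
      have hij' : (i : ℕ) ≤ j := hij
      have hjk' : (j : ℕ) ≤ k := hjk
      refine ⟨Fin.ext e3, h3 v i.modNat j.modNat k.modNat ?_ ?_ hi' hk'⟩
      · change (i : ℕ) % n ≤ (j : ℕ) % n
        omega
      · change (j : ℕ) % n ≤ (k : ℕ) % n
        omega
  · intro i
    refine (Finset.card_insert_le _ _).trans ?_
    have := (Finset.card_image_le (s := A i.modNat) (f := fun v => some (i.divNat, v)))
    have := h4 i.modNat
    omega

theorem joinCopies_anagram {V : Type} {B P k : ℕ} (G : SimpleGraph V) (r : V)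
    (hconn : G.Connected) [Finite V] (hB : Nat.card (V → Fin P) < B)
    (h : ∀ f : V → Fin P, (Set.range f).ncard ≤ k → ¬ AnagramFreeVC G f)
    (f : Option (Fin B × V) → Fin P) (hf : (Set.range f).ncard ≤ k + 1) :
    ¬ AnagramFreeVC (joinCopies B G r) f := by
  intro hfree
  obtain ⟨b, b', hne, hbb⟩ : ∃ b b' : Fin B, b ≠ b' ∧
      (fun v => f (some (b, v))) = (fun v => f (some (b', v))) := by
    by_contra! hcon
    have hinj : Function.Injective (fun (b : Fin B) (v : V) => f (some (b, v))) := by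
      intro b b' hb
      by_contra hne
      exact hcon b b' hne hb
    have := Nat.card_le_card_of_injective _ hinj
    simp only [Nat.card_eq_fintype_card, Fintype.card_fin] at this
    omega
  set g : V → Fin P := fun v => f (some (b, v)) with hg
  have hgfree : AnagramFreeVC G g := by
    intro u v p hp hA
    refine hfree (p.map (copyHom G r b)) (hp.map (copyHom_injective G r b)) ?_
    rw [SimpleGraph.Walk.support_map, List.map_map]
    exact hA
  have hgk : k < (Set.range g).ncard := by
    by_contra! hle
    exact h g hle hgfree
  have hmem : f none ∈ Set.range g := by
    by_contra hnot
    have h1 := Set.ncard_insert_of_notMem hnot (Set.toFinite _)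
    have h2 : (insert (f none) (Set.range g)).ncard ≤ (Set.range f).ncard := by
      apply Set.ncard_le_ncard _ (Set.toFinite _)
      rintro _ (rfl | ⟨v, rfl⟩)
      · exact ⟨_, rfl⟩
      · exact ⟨_, rfl⟩
    omega
  obtain ⟨x, hx⟩ := hmem
  obtain ⟨w, hw⟩ := (hconn.preconnected r x).exists_isPath
  have a1 : (joinCopies B G r).Adj (copyHom G r b r) none := rfl
  have a2 : (joinCopies B G r).Adj none (copyHom G r b' r) := rfl
  let q := (w.map (copyHom G r b)).reverse.append
    (SimpleGraph.Walk.cons a1 (SimpleGraph.Walk.cons a2 (w.map (copyHom G r b'))))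
  have hqs : q.support = (w.support.map (fun v => some (b, v))).reverse ++
      none :: w.support.map (fun v => some (b', v)) := by
    simp only [q, SimpleGraph.Walk.support_append, SimpleGraph.Walk.support_reverse,
      SimpleGraph.Walk.support_map, SimpleGraph.Walk.support_cons, List.tail_cons]
    rfl
  have hws : w.support.Nodup := hw.support_nodup
  have hq : q.IsPath := by
    rw [SimpleGraph.Walk.isPath_def, hqs, List.nodup_append]
    refine ⟨?_, ?_, ?_⟩
    · rw [List.nodup_reverse]
      exact hws.map (copyHom_injective G r b)
    · rw [List.nodup_cons]
      exact ⟨by simp, hws.map (copyHom_injective G r b')⟩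
    · intro y hy z hz hyz
      subst hyz
      simp only [List.mem_reverse, List.mem_map, List.mem_cons] at hy hz
      obtain ⟨u, _, rfl⟩ := hy
      rcases hz with hz | ⟨u', _, hz⟩
      · cases hz
      · simp only [Option.some.injEq, Prod.mk.injEq] at hz
        exact hne hz.1.symm
  have hnn : ¬ q.Nil := by
    intro hnil
    have := SimpleGraph.Walk.nil_iff_support_eq.1 hnil
    have := congrArg List.length this
    rw [hqs] at this
    simp at this
    omega
  refine hfree q.tail hq.tail ?_
  rw [SimpleGraph.Walk.support_tail_of_not_nil _ hnn, hqs]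
  have hlast : w.support = w.support.dropLast ++ [x] := by
    have := List.dropLast_append_getLast w.support_ne_nil
    rw [SimpleGraph.Walk.getLast_support] at this
    exact this.symm
  have hb' : ∀ v, f (some (b', v)) = g v := fun v => (congrFun hbb v).symm
  refine ⟨(w.support.dropLast.map g).reverse ++ [f none], w.support.map g, by simp, ?_, ?_⟩
  · conv_rhs => rw [hlast]
    rw [List.map_append, List.map_singleton, hx]
    exact (List.reverse_perm _).append_right _
  · conv_lhs => rw [hlast]
    simp [Function.comp_def, hb', ← hx, hg]

theorem exists_rooted (P k : ℕ) :
    ∃ (V : Type) (G : SimpleGraph V) (r : V) (d : V → ℕ), Finite V ∧ G.Connected ∧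
      (∀ v, d v ≤ d r → v = r) ∧
      (∀ v u w, G.Adj v u → G.Adj v w → d u ≤ d v → d w ≤ d v → u = w) ∧
      HasPathDecomp G k ∧
      ∀ f : V → Fin P, (Set.range f).ncard ≤ k → ¬ AnagramFreeVC G f := by
  induction k with
  | zero =>
    refine ⟨Unit, ⊥, (), fun _ => 0, inferInstance, ?_, by simp, by simp, ?_, ?_⟩
    · exact SimpleGraph.Connected.mk (fun u v => by cases u; cases v; exact ⟨.nil⟩)
    · refine ⟨1, fun _ => {()}, ?_, ?_, ?_, ?_⟩ <;> simp
    · intro f hf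
      rw [Nat.le_zero, Set.ncard_eq_zero (Set.toFinite _)] at hf
      exact absurd hf (Set.range_nonempty f).ne_empty
  | succ k ih =>
    obtain ⟨V, G, r, d, hfin, hconn, hroot, hd, hpd, hana⟩ := ih
    let B := Nat.card (V → Fin P) + 1
    refine ⟨Option (Fin B × V), joinCopies B G r, none,
      fun x => match x with
        | none => 0
        | some (_, v) => d v + 1, inferInstance, ?_, ?_, ?_,
      joinCopies_pathDecomp (Nat.succ_pos _) G r k hpd,
      fun f hf => joinCopies_anagram G r hconn (Nat.lt_succ_self _) hana f hf⟩
    · have hre : ∀ x, (joinCopies B G r).Reachable none x := by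
        rintro (_ | ⟨b, v⟩)
        · exact SimpleGraph.Reachable.refl _
        · have a2 : (joinCopies B G r).Adj none (copyHom G r b r) := rfl
          exact a2.reachable.trans ((hconn.preconnected r v).map (copyHom G r b))
      exact SimpleGraph.Connected.mk (fun u v => (hre u).symm.trans (hre v))
    · rintro (_ | ⟨b, v⟩) h
      · rfl
      · simp at h
    · rintro (_ | ⟨b, v⟩) (_ | ⟨b1, u⟩) (_ | ⟨b2, w⟩) h1 h2 h3 h4
      · rfl
      · exact h1.elim
      · exact h2.elim
      · simp at h3
      · rfl
      · obtain ⟨rfl, h2⟩ := h2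
        obtain rfl : v = r := h1
        have := hroot w (by simpa using h4)
        subst this
        exact (G.loopless.irrefl _ h2).elim
      · obtain ⟨rfl, h1⟩ := h1
        obtain rfl : v = r := h2
        have := hroot u (by simpa using h3)
        subst this
        exact (G.loopless.irrefl _ h1).elim
      · obtain ⟨rfl, h1⟩ := h1
        obtain ⟨rfl, h2⟩ := h2
        rw [hd v u w h1 h2 (by simpa using h3) (by simpa using h4)]

/-- For every `p ≥ 0` there is a tree of pathwidth at most `p`
whose every anagram-free vertex colouring uses at least `p` colours:
`φ(T) ≥ p ≥ pw(T)`. -/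
theorem exists_tree_pathwidth_le_and_anagramFree_chromatic_ge (p : ℕ) :
    ∃ (V : Type) (G : SimpleGraph V), Finite V ∧ G.IsTree ∧
      HasPathDecomp G p ∧
      ∀ c : ℕ, c < p → ∀ f : V → Fin c, ¬ AnagramFreeVC G f := by
  obtain ⟨V, G, r, d, hfin, hconn, hroot, hd, hpd, hana⟩ := exists_rooted p p
  refine ⟨V, G, hfin, ⟨hconn, acyclic_of_rank G d hd⟩, hpd, ?_⟩
  intro c hc f hfree
  refine hana (Fin.castLE hc.le ∘ f) ?_ ?_
  · refine (Set.ncard_le_card _).trans ?_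
    simp
  · rintro u v q hq ⟨w₁, w₂, h1, h2, h3⟩
    rw [← List.map_map, List.map_eq_append_iff] at h3
    obtain ⟨l₁, l₂, h3, rfl, rfl⟩ := h3
    refine hfree q hq ⟨l₁, l₂, by simpa using h1, ?_, h3⟩
    exact (List.map_perm_map_iff (Fin.castLE_injective hc.le)).1 h2
end

section
/- For every integer k ≥ 2, the k-anagram-free chromatic number is unbounded on graphs of maximum degree k + 1: for every positive integer c there exists a graph G with maximum degree at most k + 1 such that G has no k-anagram-free vertex colouring using at most c colours. -/
namespace KAna

/-- Vertices: side, kind (`true` = branching vertex, `false` = connector), word. -/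
abbrev Vtx (k : ℕ) := Bool × Bool × List (Fin k)

/-- The generating relation of the graph. -/
def Rel (k h : ℕ) (u v : Vtx k) : Prop :=
  (∃ s x, u = (s, true, x) ∧ v = (s, false, x)) ∨
  (∃ s x j, x.length < h ∧ u = (s, true, x) ∧ v = (s, false, j :: x)) ∨
  (∃ s x, x.length = h ∧ u = (s, true, x) ∧ v = (!s, true, x)) ∨
  (∃ s x, ∃ i j : Fin k, i.val + 1 = j.val ∧ s = decide (i.val % 2 = 0) ∧
    u = (s, false, i :: x) ∧ v = (s, false, j :: x))

/-- The ambient graph (on infinitely many vertices). -/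
def Gr (k h : ℕ) : SimpleGraph (Vtx k) := SimpleGraph.fromRel (Rel k h)

/-- The upward list from the branching vertex of `p ++ y` to the connector of `y`. -/
def U {k : ℕ} (s : Bool) : List (Fin k) → List (Fin k) → List (Vtx k)
  | [], y => [(s, true, y), (s, false, y)]
  | a :: p, y => (s, true, a :: (p ++ y)) :: (s, false, a :: (p ++ y)) :: U s p y

lemma U_append {k : ℕ} (s : Bool) (p : List (Fin k)) (j : Fin k) (x : List (Fin k)) :
    U s (p ++ j :: x) [] = U s p (j :: x) ++ U s x [] := by
  induction p with
  | nil => simp [U]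
  | cons a p ih => simp [U, ih]

lemma U_length {k : ℕ} (s : Bool) (p y : List (Fin k)) :
    (U s p y).length = 2 * (p.length + 1) := by
  induction p with
  | nil => simp [U]
  | cons a p ih => simp [U, ih]; ring

lemma mem_U {k : ℕ} {s : Bool} {p y : List (Fin k)} {v : Vtx k} (hv : v ∈ U s p y) :
    v.1 = s ∧ ∃ q, q.length ≤ p.length ∧ v.2.2 = q ++ y := by
  induction p with
  | nil =>
    simp [U] at hv
    rcases hv with rfl | rfl <;> simp
  | cons a p ih =>
    simp [U] at hv
    rcases hv with rfl | rfl | hv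
    · exact ⟨rfl, a :: p, by simp, by simp⟩
    · exact ⟨rfl, a :: p, by simp, by simp⟩
    · obtain ⟨h1, q, h2, h3⟩ := ih hv
      exact ⟨h1, q, by simp; omega, h3⟩

lemma U_nodup {k : ℕ} (s : Bool) (p y : List (Fin k)) : (U s p y).Nodup := by
  induction p with
  | nil => simp [U]
  | cons a p ih =>
    have key : ∀ b, (s, b, a :: (p ++ y)) ∉ U s p y := by
      intro b hb
      obtain ⟨-, q, h2, h3⟩ := mem_U hb
      have := congrArg List.length h3
      simp at this
      omega
    simp [U, ih, key]

lemma U_head {k : ℕ} (s : Bool) (p y : List (Fin k)) :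
    (U s p y).head? = some (s, true, p ++ y) := by
  cases p <;> simp [U]

lemma U_getLast {k : ℕ} (s : Bool) (p y : List (Fin k)) :
    (U s p y).getLast? = some (s, false, y) := by
  induction p with
  | nil => simp [U]
  | cons a p ih => simp [U, List.getLast?_cons, ih]

lemma adj_TA {k h : ℕ} (s : Bool) (x : List (Fin k)) :
    (Gr k h).Adj (s, true, x) (s, false, x) := by
  refine (SimpleGraph.fromRel_adj _ _ _).2 ⟨by simp, Or.inl (Or.inl ⟨s, x, rfl, rfl⟩)⟩

lemma adj_down {k h : ℕ} (s : Bool) (x : List (Fin k)) (j : Fin k) (hx : x.length < h) :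
    (Gr k h).Adj (s, false, j :: x) (s, true, x) := by
  refine (SimpleGraph.fromRel_adj _ _ _).2 ⟨by simp, Or.inr (Or.inr (Or.inl ⟨s, x, j, hx, rfl, rfl⟩))⟩

lemma adj_cross {k h : ℕ} (s : Bool) (x : List (Fin k)) (hx : x.length = h) :
    (Gr k h).Adj (s, true, x) (!s, true, x) := by
  refine (SimpleGraph.fromRel_adj _ _ _).2
    ⟨by simp, Or.inl (Or.inr (Or.inr (Or.inl ⟨s, x, hx, rfl, rfl⟩)))⟩

lemma adj_sib {k h : ℕ} (s : Bool) (x : List (Fin k)) (i j : Fin k) (hij : i.val + 1 = j.val)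
    (hs : s = decide (i.val % 2 = 0)) :
    (Gr k h).Adj (s, false, i :: x) (s, false, j :: x) := by
  refine (SimpleGraph.fromRel_adj _ _ _).2
    ⟨?_, Or.inl (Or.inr (Or.inr (Or.inr ⟨s, x, i, j, hij, hs, rfl, rfl⟩)))⟩
  simp
  rintro rfl
  omega

lemma U_chain {k h : ℕ} (s : Bool) (p y : List (Fin k)) (hl : (p ++ y).length ≤ h) :
    (U s p y).IsChain (Gr k h).Adj := by
  induction p with
  | nil => simpa [U] using adj_TA s y
  | cons a p ih =>
    simp only [U]
    have hl' : (p ++ y).length < h := by simp at hl ⊢; omega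
    rw [List.isChain_cons_cons, List.isChain_cons]
    refine ⟨adj_TA _ _, ?_, ih hl'.le⟩
    intro v hv
    rw [U_head] at hv
    simp at hv
    subst hv
    exact adj_down _ _ _ hl'

/-- A full segment: down on side `s`, across at the leaf, up on side `!s`. -/
def Seg {k : ℕ} (s : Bool) (p y : List (Fin k)) : List (Vtx k) :=
  (U s p y).reverse ++ U (!s) p y

lemma Seg_head {k : ℕ} (s : Bool) (p y : List (Fin k)) :
    (Seg s p y).head? = some (s, false, y) := by
  simp [Seg, List.head?_append, U_getLast]

lemma Seg_getLast {k : ℕ} (s : Bool) (p y : List (Fin k)) :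
    (Seg s p y).getLast? = some (!s, false, y) := by
  simp [Seg, List.getLast?_append, U_getLast]

lemma Seg_chain {k h : ℕ} (s : Bool) (p y : List (Fin k)) (hl : (p ++ y).length = h) :
    (Seg s p y).IsChain (Gr k h).Adj := by
  rw [Seg, List.isChain_append]
  refine ⟨?_, U_chain _ _ _ hl.le, ?_⟩
  · rw [List.isChain_reverse]
    exact (U_chain s p y hl.le).imp fun a b hab => hab.symm
  · intro a ha b hb
    rw [List.getLast?_reverse, U_head] at ha
    rw [U_head] at hb
    simp at ha hb
    subst ha hb
    exact adj_cross _ _ hl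

lemma mem_Seg {k : ℕ} {s : Bool} {p y : List (Fin k)} {v : Vtx k} (hv : v ∈ Seg s p y) :
    ∃ q, q.length ≤ p.length ∧ v.2.2 = q ++ y := by
  simp [Seg] at hv
  rcases hv with hv | hv <;> exact (mem_U hv).2

lemma Seg_nodup {k : ℕ} (s : Bool) (p y : List (Fin k)) : (Seg s p y).Nodup := by
  rw [Seg, List.nodup_append]
  refine ⟨List.nodup_reverse.2 (U_nodup _ _ _), U_nodup _ _ _, ?_⟩
  rintro a ha b hb rfl
  have h1 := (mem_U (List.mem_reverse.1 ha)).1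
  have h2 := (mem_U hb).1
  rw [h1] at h2
  simp at h2

lemma Seg_perm {k : ℕ} (s : Bool) (p y : List (Fin k)) :
    (Seg s p y).Perm (U true p y ++ U false p y) := by
  cases s
  · exact ((List.reverse_perm _).append_right _).trans List.perm_append_comm
  · exact ((List.reverse_perm _).append_right _)

lemma flatten_chain {α : Type*} {R : α → α → Prop} : ∀ {L : List (List α)},
    (∀ l ∈ L, l ≠ []) → (∀ l ∈ L, l.IsChain R) →
    L.IsChain (fun a b => ∀ x ∈ a.getLast?, ∀ y ∈ b.head?, R x y) → L.flatten.IsChain R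
  | [], _, _, _ => by simp
  | [a], _, h, _ => by simpa using h
  | a :: b :: L, h0, h, hc => by
    rw [List.flatten_cons, List.isChain_append]
    rw [List.isChain_cons_cons] at hc
    refine ⟨h a (by simp), flatten_chain (fun l hl => h0 l (by simp [hl]))
      (fun l hl => h l (by simp at hl ⊢; tauto)) hc.2, ?_⟩
    intro x hx y hy
    refine hc.1 x hx y ?_
    have hb : b ≠ [] := h0 b (by simp)
    cases b with
    | nil => exact absurd rfl hb
    | cons c b => simpa using hy

/-- Dense sets of leaves contain a fully branching node. -/
lemma exists_branch {k : ℕ} : ∀ (h : ℕ) (F : Finset (List (Fin k))),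
    (∀ l ∈ F, l.length = h) → (k - 1) ^ h < F.card →
    ∃ x, ∀ j : Fin k, ∃ p, p ++ j :: x ∈ F := by
  intro h
  induction h with
  | zero =>
    intro F hF hc
    exfalso
    have : F.card ≤ 1 := by
      rw [Finset.card_le_one]
      intro a ha b hb
      rw [List.length_eq_zero_iff.1 (hF a ha), List.length_eq_zero_iff.1 (hF b hb)]
    simp at hc
    omega
  | succ h ih =>
    intro F hF hc
    by_cases hx : ∃ x, ∀ j : Fin k, j :: x ∈ F
    · obtain ⟨x, hx⟩ := hx
      exact ⟨x, fun j => ⟨[], hx j⟩⟩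
    push Not at hx
    have hcard : F.card ≤ (k - 1) * (F.image List.tail).card := by
      apply Finset.card_le_mul_card_image
      intro t ht
      obtain ⟨j, hj⟩ := hx t
      have : F.filter (fun a => a.tail = t) ⊆ (Finset.univ.erase j).image (fun i => i :: t) := by
        intro l hl
        rw [Finset.mem_filter] at hl
        have hlen := hF l hl.1
        cases l with
        | nil => simp at hlen
        | cons i l =>
          obtain ⟨h1, h2⟩ := hl
          simp at h2
          subst h2
          rw [Finset.mem_image]
          refine ⟨i, ?_, rfl⟩
          simp
          rintro rfl
          exact hj h1
      refine (Finset.card_le_card this).trans (Finset.card_image_le.trans ?_)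
      simp [Finset.card_erase_of_mem]
    obtain ⟨x, hx'⟩ := ih (F.image List.tail) (by
      intro l hl
      obtain ⟨a, ha, rfl⟩ := Finset.mem_image.1 hl
      simp [hF a ha]) (by
      by_contra hcon
      push Not at hcon
      have : (k - 1) * (F.image List.tail).card ≤ (k - 1) * (k - 1) ^ h :=
        Nat.mul_le_mul_left _ hcon
      rw [pow_succ'] at hc
      omega)
    refine ⟨x, fun j => ?_⟩
    obtain ⟨p, hp⟩ := hx' j
    obtain ⟨a, ha, hap⟩ := Finset.mem_image.1 hp
    have hlen := hF a ha
    cases a with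
    | nil => simp at hlen
    | cons i l =>
      simp at hap
      exact ⟨i :: p, by simpa [← hap] using ha⟩

lemma exists_h (k c : ℕ) (hk : 2 ≤ k) :
    ∃ h : ℕ, (4 * h + 5) ^ c * (k - 1) ^ h < k ^ h := by
  obtain ⟨m, rfl⟩ : ∃ m, k = m + 1 := ⟨k - 1, by omega⟩
  have hm : (0 : ℝ) < m := by
    have : 0 < m := by omega
    exact_mod_cast this
  have hr : (1 : ℝ) < (m + 1) / m := by
    rw [lt_div_iff₀ hm]; linarith
  have ht := tendsto_pow_const_div_const_pow_of_one_lt c hr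
  have h9 : (0 : ℝ) < 1 / 9 ^ c := by positivity
  obtain ⟨h, hh, h1⟩ := ((ht.eventually (gt_mem_nhds h9)).and
    (Filter.eventually_ge_atTop 1)).exists
  refine ⟨h, ?_⟩
  simp only [Nat.add_sub_cancel]
  have hle : (4 * h + 5) ^ c ≤ (9 * h) ^ c := Nat.pow_le_pow_left (by omega) _
  refine lt_of_le_of_lt (Nat.mul_le_mul_right _ hle) ?_
  have : ((9 * h : ℝ)) ^ c * (m : ℝ) ^ h < (m + 1 : ℝ) ^ h := by
    rw [div_pow, div_div_eq_mul_div, div_lt_div_iff₀ (by positivity) (by positivity)] at hh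
    rw [mul_pow]
    linarith
  exact_mod_cast this

lemma Gr_adj_T {k h : ℕ} {s : Bool} {x : List (Fin k)} {v : Vtx k}
    (hv : (Gr k h).Adj (s, true, x) v) :
    v = (s, false, x) ∨ (x.length < h ∧ ∃ j, v = (s, false, j :: x)) ∨
      (x.length = h ∧ v = (!s, true, x)) := by
  obtain ⟨-, hv⟩ := (SimpleGraph.fromRel_adj _ _ _).1 hv
  rcases hv with (⟨s', x', h1, rfl⟩ | ⟨s', x', j, hl, h1, rfl⟩ | ⟨s', x', hl, h1, rfl⟩ |
    ⟨s', x', i, j, hij, hs, h1, rfl⟩) | (⟨s', x', rfl, h1⟩ | ⟨s', x', j, hl, rfl, h1⟩ |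
    ⟨s', x', hl, rfl, h1⟩ | ⟨s', x', i, j, hij, hs, rfl, h1⟩)
  all_goals simp at h1
  all_goals obtain ⟨rfl, rfl⟩ := h1
  · simp
  · simp [hl]
  · simp [hl]
  · simp [hl]

lemma Gr_adj_A {k h : ℕ} {s : Bool} {y : List (Fin k)} {v : Vtx k}
    (hv : (Gr k h).Adj (s, false, y) v) :
    v = (s, true, y) ∨ v = (s, true, y.tail) ∨
      ∃ i j : Fin k, ∃ x, y = i :: x ∧ v = (s, false, j :: x) ∧
        j.val = if s = decide (i.val % 2 = 0) then i.val + 1 else i.val - 1 := by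
  obtain ⟨-, hv⟩ := (SimpleGraph.fromRel_adj _ _ _).1 hv
  rcases hv with (⟨s', x', h1, rfl⟩ | ⟨s', x', j, hl, h1, rfl⟩ | ⟨s', x', hl, h1, rfl⟩ |
    ⟨s', x', i, j, hij, hs, h1, rfl⟩) | (⟨s', x', rfl, h1⟩ | ⟨s', x', j, hl, rfl, h1⟩ |
    ⟨s', x', hl, rfl, h1⟩ | ⟨s', x', i, j, hij, hs, rfl, h1⟩)
  all_goals simp at h1
  all_goals obtain ⟨rfl, rfl⟩ := h1
  · refine Or.inr (Or.inr ⟨i, j, x', rfl, rfl, ?_⟩)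
    rw [if_pos hs]; omega
  · simp
  · simp
  · refine Or.inr (Or.inr ⟨j, i, x', rfl, rfl, ?_⟩)
    rw [if_neg]
    · omega
    · rw [hs]
      by_cases h : i.val % 2 = 0
      · have : ¬ j.val % 2 = 0 := by omega
        simp [h, this]
      · have : j.val % 2 = 0 := by omega
        simp [h, this]

lemma Gr_degree {k h : ℕ} (hk : 2 ≤ k) (v : Vtx k) :
    ∃ S : Finset (Vtx k), S.card ≤ k + 1 ∧ ∀ w, (Gr k h).Adj v w → w ∈ S := by
  classical
  obtain ⟨s, b, y⟩ := v
  cases b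
  · by_cases hex : ∃ i j : Fin k, ∃ x, y = i :: x ∧
        j.val = if s = decide (i.val % 2 = 0) then i.val + 1 else i.val - 1
    · obtain ⟨i, j, x, rfl, hj⟩ := hex
      refine ⟨{(s, true, i :: x), (s, true, x), (s, false, j :: x)},
        Finset.card_le_three.trans (by omega), fun w hw => ?_⟩
      rcases Gr_adj_A hw with rfl | rfl | ⟨i', j', x', h1, rfl, h2⟩
      · simp
      · simp
      · simp at h1
        obtain ⟨rfl, rfl⟩ := h1
        have : j' = j := Fin.ext (by rw [h2, hj])
        simp [this]
    · refine ⟨{(s, true, y), (s, true, y.tail)},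
        Finset.card_le_two.trans (by omega), fun w hw => ?_⟩
      rcases Gr_adj_A hw with rfl | rfl | ⟨i', j', x', h1, rfl, h2⟩
      · simp
      · simp
      · exact absurd ⟨i', j', x', h1, h2⟩ hex
  · by_cases hl : y.length < h
    · refine ⟨insert (s, false, y) (Finset.univ.image fun j => (s, false, j :: y)), ?_,
        fun w hw => ?_⟩
      · refine (Finset.card_insert_le _ _).trans ?_
        have := Finset.card_image_le (s := (Finset.univ : Finset (Fin k)))
          (f := fun j => ((s, false, j :: y) : Vtx k))
        simp at this
        omega
      · rcases Gr_adj_T hw with rfl | ⟨_, j, rfl⟩ | ⟨h1, _⟩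
        · simp
        · simp
        · omega
    · refine ⟨{(s, false, y), (!s, true, y)},
        Finset.card_le_two.trans (by omega), fun w hw => ?_⟩
      rcases Gr_adj_T hw with rfl | ⟨h1, _⟩ | ⟨_, rfl⟩
      · simp
      · exact absurd h1 hl
      · simp

/-- The main combinatorial statement on the ambient graph. -/
lemma exists_path {k h c : ℕ} (hk : 2 ≤ k) (hh : (4 * h + 5) ^ c * (k - 1) ^ h < k ^ h)
    (g : Vtx k → Fin c) :
    ∃ L : List (Vtx k), L ≠ [] ∧ (∀ v ∈ L, v.2.2.length ≤ h) ∧ L.IsChain (Gr k h).Adj ∧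
      L.Nodup ∧ IsKAnagram k (L.map g) := by
  classical
  let leaves : Finset (List (Fin k)) :=
    (Finset.univ : Finset (Fin h → Fin k)).image List.ofFn
  have hleaves : leaves.card = k ^ h := by
    rw [Finset.card_image_of_injective _ List.ofFn_injective]
    simp
  have hlen : ∀ l ∈ leaves, l.length = h := by
    intro l hl
    obtain ⟨a, -, rfl⟩ := Finset.mem_image.1 hl
    simp
  let word : List (Fin k) → List (Fin k) → List (Fin c) :=
    fun p y => (U true p y ++ U false p y).map g
  let cls : List (Fin k) → Fin c → ℕ := fun l i => (word l []).count i
  obtain ⟨y, -, hy⟩ := Finset.exists_lt_card_fiber_of_mul_lt_card_of_maps_to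
    (s := leaves) (t := Fintype.piFinset fun _ : Fin c => Finset.range (4 * h + 5))
    (f := cls) (n := (k - 1) ^ h) (by
      intro l hl
      rw [Fintype.mem_piFinset]
      intro i
      rw [Finset.mem_range]
      have h1 : (word l []).count i ≤ (word l []).length := List.count_le_length
      have h2 : (word l []).length = 4 * h + 4 := by
        simp [word, U_length, hlen l hl]; ring
      have : cls l i = (word l []).count i := rfl
      omega) (by simpa [hleaves] using hh)
  obtain ⟨x, hx⟩ := exists_branch h _ (by
    intro l hl
    exact hlen l (Finset.mem_filter.1 hl).1) hy
  choose p hp using hx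
  have hp1 : ∀ j, (p j ++ j :: x).length = h := fun j => hlen _ (Finset.mem_filter.1 (hp j)).1
  have hp2 : ∀ j, cls (p j ++ j :: x) = y := fun j => (Finset.mem_filter.1 (hp j)).2
  have hword : ∀ i j, (word (p i) (i :: x)).Perm (word (p j) (j :: x)) := by
    intro i j
    rw [List.perm_iff_count]
    intro a
    have h1 := congrFun ((hp2 i).trans (hp2 j).symm) a
    simp only [cls, word, U_append, List.map_append, List.count_append] at h1 ⊢
    omega
  let sd : Fin k → Bool := fun j => decide (j.val % 2 = 1)
  let S : Fin k → List (Vtx k) := fun j => Seg (sd j) (p j) (j :: x)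
  have hS0 : ∀ j, S j ≠ [] := by
    intro j hj
    have := Seg_head (sd j) (p j) (j :: x)
    rw [show Seg (sd j) (p j) (j :: x) = [] from hj] at this
    simp at this
  let j0 : Fin k := ⟨0, by omega⟩
  refine ⟨(List.ofFn S).flatten, ?_, ?_, ?_, ?_, ?_⟩
  · intro h0
    rw [List.flatten_eq_nil_iff] at h0
    exact hS0 j0 (h0 _ (by simp [List.mem_ofFn]))
  · intro v hv
    obtain ⟨l, hl, hv⟩ := List.mem_flatten.1 hv
    obtain ⟨j, rfl⟩ := (List.mem_ofFn' _ _).1 hl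
    obtain ⟨q, h1, h2⟩ := mem_Seg hv
    have h3 := hp1 j
    rw [h2]
    simp at h3 ⊢
    omega
  · apply flatten_chain
    · intro l hl
      obtain ⟨j, rfl⟩ := (List.mem_ofFn' _ _).1 hl
      exact hS0 j
    · intro l hl
      obtain ⟨j, rfl⟩ := (List.mem_ofFn' _ _).1 hl
      exact Seg_chain _ _ _ (hp1 j)
    · rw [List.isChain_ofFn]
      intro i hi a ha b hb
      simp only [S, Seg_getLast, Seg_head, Option.mem_def, Option.some.injEq] at ha hb
      subst ha hb
      have e1 : (!(sd ⟨i, by omega⟩)) = decide (i % 2 = 0) := by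
        by_cases h : i % 2 = 0 <;> simp [sd, h] <;> omega
      have e2 : sd ⟨i + 1, hi⟩ = decide (i % 2 = 0) := by
        simp only [sd]
        congr 1
        simp only [eq_iff_iff]
        omega
      rw [e1, e2]
      exact adj_sib _ _ _ _ rfl rfl
  · rw [List.nodup_flatten]
    constructor
    · intro l hl
      obtain ⟨j, rfl⟩ := (List.mem_ofFn' _ _).1 hl
      exact Seg_nodup _ _ _
    · rw [List.pairwise_ofFn]
      intro i j hij v hv1 hv2
      obtain ⟨q1, -, h1⟩ := mem_Seg hv1
      obtain ⟨q2, -, h2⟩ := mem_Seg hv2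
      have h3 := (List.append_inj' (h1.symm.trans h2) (by simp)).2
      simp at h3
      exact hij.ne h3
  · refine ⟨word (p j0) (j0 :: x), (List.ofFn S).map (List.map g), ?_, by simp, ?_, ?_⟩
    · intro h0
      have := congrArg List.length h0
      simp [word, U_length] at this
    · intro w hw
      obtain ⟨l, hl, rfl⟩ := List.mem_map.1 hw
      obtain ⟨j, rfl⟩ := (List.mem_ofFn' _ _).1 hl
      exact ((Seg_perm _ _ _).map g).trans (hword j j0)
    · rw [List.map_flatten]

end KAna

/-- For every `k ≥ 2` the `k`-anagram-free chromatic number is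
unbounded on graphs of maximum degree `k + 1`: for every positive `c` there is
a finite graph of maximum degree at most `k + 1` with no `k`-anagram-free
vertex colouring using at most `c` colours. -/
theorem kAnagramFree_chromatic_unbounded_maxDegree (k : ℕ) (hk : 2 ≤ k) :
    ∀ c : ℕ, 0 < c →
      ∃ (V : Type) (G : SimpleGraph V), Finite V ∧
        (∀ v : V, (G.neighborSet v).ncard ≤ k + 1) ∧
        ∀ f : V → Fin c, ¬ KAnagramFreeVC k G f := by
  classical
  intro c hc
  obtain ⟨h, hh⟩ := KAna.exists_h k c hk
  refine ⟨{v : KAna.Vtx k // v.2.2.length ≤ h}, (KAna.Gr k h).comap Subtype.val, ?_, ?_, ?_⟩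
  · have hf : ((Set.univ : Set Bool) ×ˢ ((Set.univ : Set Bool) ×ˢ
        {l : List (Fin k) | l.length ≤ h})).Finite :=
      Set.finite_univ.prod (Set.finite_univ.prod (List.finite_length_le _ _))
    exact (hf.subset (fun v hv => by
      have hv' : v.2.2.length ≤ h := hv
      simpa using hv')).to_subtype
  · intro v
    obtain ⟨S, hS, hS'⟩ := KAna.Gr_degree (h := h) hk v.1
    rw [← Set.ncard_image_of_injective _ Subtype.val_injective]
    refine le_trans (Set.ncard_le_ncard (t := (S : Set (KAna.Vtx k))) ?_ S.finite_toSet) ?_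
    · rintro _ ⟨w, hw, rfl⟩
      exact hS' _ hw
    · rwa [Set.ncard_coe_finset]
  · intro f hf
    let g : KAna.Vtx k → Fin c := fun v => if hv : v.2.2.length ≤ h then f ⟨v, hv⟩ else ⟨0, hc⟩
    obtain ⟨L, h0, hL, hch, hnd, hana⟩ := KAna.exists_path hk hh g
    lift L to List {v : KAna.Vtx k // v.2.2.length ≤ h} using hL
    rw [List.isChain_map] at hch
    replace hch : L.IsChain ((KAna.Gr k h).comap Subtype.val).Adj := hch
    have h0' : L ≠ [] := by simpa using h0
    refine hf (SimpleGraph.Walk.ofSupport L h0' hch) ?_ ?_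
    · rw [SimpleGraph.Walk.isPath_def, SimpleGraph.Walk.support_ofSupport]
      exact hnd.of_map
    · rw [SimpleGraph.Walk.support_ofSupport]
      have : L.map f = (L.map Subtype.val).map g := by
        rw [List.map_map]
        apply List.map_congr_left
        intro a _
        simp [g, a.2]
      rw [this]
      exact hana
end
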